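/- arXiv:0803.0552 — 8 statements merged into one kernel-verified Lean document; each statement's English description precedes it below -/
import Mathlib

section
/- (Sewing map.) Let μ > 1. For every h ∈ C_3(V) with δh = 0 and ‖h‖_μ < ∞ there exists a unique M ∈ C_2(V) such that δM = h and ‖M‖_ν < ∞ for some ν > 1; moreover this M satisfies ‖M‖_μ ≤ (2^μ − 2)^{−1} ‖h‖_μ. Consequently there is a unique map Λ : ZC_3^{1+}(V) → C_2^{1+}(V) with δ∘Λ = Id on ZC_3^{1+}(V), and Λ is linear and maps ZC_3^μ(V) into C_2^μ(V) with ‖Λh‖_μ ≤ (2^μ − 2)^{−1} ‖h‖_μ. -/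
open scoped BigOperators

universe u

variable {V : Type u}

/-- Membership in `C₂(V)`: 1-increments on `[0,T]²` vanish on the diagonal. -/
def MemC2 (T : ℝ) [Zero V] (g : ℝ → ℝ → V) : Prop :=
  ∀ t ∈ Set.Icc (0 : ℝ) T, g t t = 0

/-- Membership in `C₃(V)`: 2-increments vanish when two consecutive arguments coincide. -/
def MemC3 (T : ℝ) [Zero V] (h : ℝ → ℝ → ℝ → V) : Prop :=
  ∀ t ∈ Set.Icc (0 : ℝ) T, ∀ u ∈ Set.Icc (0 : ℝ) T, ∀ s ∈ Set.Icc (0 : ℝ) T,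
    t = u ∨ u = s → h t u s = 0

/-- `(δg)_{tus} = g_{ts} − g_{tu} − g_{us}`. -/
def delta2 [AddCommGroup V] (g : ℝ → ℝ → V) : ℝ → ℝ → ℝ → V :=
  fun t u s => g t s - g t u - g u s

/-- `δh = 0` on `[0,T]⁴` for a 2-increment `h`
(`(δh)(t,u,v,s) = −h(u,v,s) + h(t,v,s) − h(t,u,s) + h(t,u,v)`). -/
def ZD3 (T : ℝ) [AddCommGroup V] (h : ℝ → ℝ → ℝ → V) : Prop :=
  ∀ t ∈ Set.Icc (0 : ℝ) T, ∀ u ∈ Set.Icc (0 : ℝ) T, ∀ v ∈ Set.Icc (0 : ℝ) T,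
    ∀ s ∈ Set.Icc (0 : ℝ) T, h u v s - h t v s + h t u s - h t u v = 0

/-- `h = Σᵢ hᵢ` on `[0,T]³` with `hᵢ ∈ C₃(V)` and
`‖hᵢ(t,u,s)‖ ≤ Kᵢ |u−s|^{ρᵢ} |t−u|^{μ−ρᵢ}`, `ρᵢ ∈ (0,μ)`; witnessing
`‖h‖_μ ≤ Σᵢ Kᵢ` for the norm of Section 2.1. -/
def DecompBound (T μ : ℝ) [NormedAddCommGroup V] (h : ℝ → ℝ → ℝ → V)
    (n : ℕ) (hs : Fin n → ℝ → ℝ → ℝ → V) (ρ K : Fin n → ℝ) : Prop :=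
  (∀ i, ρ i ∈ Set.Ioo 0 μ) ∧ (∀ i, 0 ≤ K i) ∧ (∀ i, MemC3 T (hs i)) ∧
  (∀ t ∈ Set.Icc (0 : ℝ) T, ∀ u ∈ Set.Icc (0 : ℝ) T, ∀ s ∈ Set.Icc (0 : ℝ) T,
    h t u s = ∑ i, hs i t u s) ∧
  ∀ i, ∀ t ∈ Set.Icc (0 : ℝ) T, ∀ u ∈ Set.Icc (0 : ℝ) T, ∀ s ∈ Set.Icc (0 : ℝ) T,
    ‖hs i t u s‖ ≤ K i * |u - s| ^ ρ i * |t - u| ^ (μ - ρ i)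

/-- Membership in `C₂^{1+}(V)`: Hölder regularity of order `ν` for some `ν > 1`. -/
def C2plus (T : ℝ) [NormedAddCommGroup V] (g : ℝ → ℝ → V) : Prop :=
  ∃ ν : ℝ, 1 < ν ∧ ∃ K : ℝ, 0 ≤ K ∧
    ∀ t ∈ Set.Icc (0 : ℝ) T, ∀ s ∈ Set.Icc (0 : ℝ) T, ‖g t s‖ ≤ K * |t - s| ^ ν

/-- Membership in `ZC₃^{1+}(V) = ∪_{μ>1} ZC₃^μ(V)`. -/
def ZC1p (T : ℝ) [NormedAddCommGroup V] (h : ℝ → ℝ → ℝ → V) : Prop :=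
  MemC3 T h ∧ ZD3 T h ∧ ∃ μ : ℝ, 1 < μ ∧ ∃ n hs ρ K, DecompBound T μ h n hs ρ K

lemma sew_r_lt (μ : ℝ) (hμ : 1 < μ) : 0 < (2:ℝ)^μ ∧ 2 < (2:ℝ)^μ := by
  refine ⟨by positivity, ?_⟩
  have := Real.rpow_lt_rpow_of_exponent_lt (x := 2) (by norm_num) hμ
  simpa using this

lemma sew_half (μ L : ℝ) (hL : 0 ≤ L) : (L/2)^μ = L^μ / (2:ℝ)^μ :=
  Real.div_rpow hL (by norm_num) μ

lemma sew_mid {T t s : ℝ} (ht : t ∈ Set.Icc (0:ℝ) T) (hs : s ∈ Set.Icc (0:ℝ) T) :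
    (t+s)/2 ∈ Set.Icc (0:ℝ) T := by
  obtain ⟨a, b⟩ := ht
  obtain ⟨c, d⟩ := hs
  constructor <;> linarith

lemma sew_absmid (t s : ℝ) : |t - (t+s)/2| = |t-s|/2 ∧ |(t+s)/2 - s| = |t-s|/2 := by
  have h2 : |(2:ℝ)| = 2 := by norm_num
  constructor
  · rw [show t - (t+s)/2 = (t-s)/2 by ring, abs_div, h2]
  · rw [show (t+s)/2 - s = (t-s)/2 by ring, abs_div, h2]

/-- Sharp bound from a crude bound. -/
lemma sew_sharp {V : Type u} [NormedAddCommGroup V] (T μ : ℝ) (hμ : 1 < μ) (M : ℝ → ℝ → V)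
    (A K : ℝ)
    (hmid : ∀ t ∈ Set.Icc (0 : ℝ) T, ∀ s ∈ Set.Icc (0 : ℝ) T,
      ‖M t s - M t ((t+s)/2) - M ((t+s)/2) s‖ ≤ A * (|t-s|/2)^μ)
    (hK : ∀ t ∈ Set.Icc (0 : ℝ) T, ∀ s ∈ Set.Icc (0 : ℝ) T, ‖M t s‖ ≤ K * |t-s|^μ) :
    ∀ t ∈ Set.Icc (0 : ℝ) T, ∀ s ∈ Set.Icc (0 : ℝ) T,
      ‖M t s‖ ≤ ((2:ℝ)^μ - 2)⁻¹ * A * |t-s|^μ := by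
  obtain ⟨h0, h2⟩ := sew_r_lt μ hμ
  set P := (2:ℝ)^μ with hP
  have hP2 : P - 2 ≠ 0 := by linarith
  have key : ∀ n : ℕ, ∀ t ∈ Set.Icc (0 : ℝ) T, ∀ s ∈ Set.Icc (0 : ℝ) T,
      ‖M t s‖ ≤ ((P - 2)⁻¹ * A + (K - (P-2)⁻¹ * A) * (2/P)^n) * |t-s|^μ := by
    intro n
    induction n with
    | zero =>
      intro t ht s hs
      refine (hK t ht s hs).trans (le_of_eq ?_)
      simp
    | succ n ih =>
      intro t ht s hs
      have hm := sew_mid ht hs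
      have e1 := ih t ht _ hm
      have e2 := ih _ hm s hs
      have e3 := hmid t ht s hs
      rw [(sew_absmid t s).1] at e1
      rw [(sew_absmid t s).2] at e2
      rw [sew_half μ _ (abs_nonneg _)] at e1 e2 e3
      have tri : ‖M t s‖ ≤ ‖M t s - M t ((t+s)/2) - M ((t+s)/2) s‖ + ‖M t ((t+s)/2)‖
          + ‖M ((t+s)/2) s‖ := by
        have := norm_add₃_le (a := M t s - M t ((t+s)/2) - M ((t+s)/2) s)
          (b := M t ((t+s)/2)) (c := M ((t+s)/2) s)
        refine le_trans (le_of_eq ?_) this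
        congr 1
        abel
      refine (tri.trans (add_le_add (add_le_add e3 e1) e2)).trans (le_of_eq ?_)
      rw [← hP, pow_succ]
      field_simp
      ring
  intro t ht s hs
  have hr : Filter.Tendsto (fun n : ℕ => (2/P)^n) Filter.atTop (nhds 0) :=
    tendsto_pow_atTop_nhds_zero_of_lt_one (by positivity) (by rw [div_lt_one h0]; exact h2)
  have hl : Filter.Tendsto
      (fun n : ℕ => ((P - 2)⁻¹ * A + (K - (P-2)⁻¹ * A) * (2/P)^n) * |t-s|^μ) Filter.atTop
      (nhds (((P - 2)⁻¹ * A + (K - (P-2)⁻¹ * A) * 0) * |t-s|^μ)) :=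
    ((hr.const_mul _).const_add _).mul_const _
  have := ge_of_tendsto' hl (fun n => key n t ht s hs)
  simpa using this

lemma sew_pick (n : ℕ) (hn : 0 < n) (z : ℕ → ℝ) (hz : z 0 ≤ z n) :
    ∃ p < n, z p - z 0 ≤ (z n - z 0)/2 ∧ z n - z (p+1) ≤ (z n - z 0)/2 := by
  classical
  have hex : ∃ q, z n - z (q+1) ≤ (z n - z 0)/2 :=
    ⟨n-1, by rw [Nat.sub_add_cancel hn]; linarith⟩
  refine ⟨Nat.find hex, ?_, ?_, Nat.find_spec hex⟩
  · have : Nat.find hex ≤ n - 1 := Nat.find_min' hex (by rw [Nat.sub_add_cancel hn]; linarith)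
    omega
  · rcases Nat.eq_zero_or_pos (Nat.find hex) with h0 | h0
    · rw [h0]; linarith
    · have := Nat.find_min hex (m := Nat.find hex - 1) (by omega)
      rw [Nat.sub_add_cancel h0] at this
      linarith

/-- Young-type maximal inequality. -/
lemma sew_young {V : Type u} [NormedAddCommGroup V] (T μ : ℝ) (hμ : 1 < μ) (B : ℝ → ℝ → V)
    (A : ℝ) (hA : 0 ≤ A) (hdiag : ∀ t ∈ Set.Icc (0 : ℝ) T, B t t = 0)
    (hB : ∀ t ∈ Set.Icc (0 : ℝ) T, ∀ u ∈ Set.Icc (0 : ℝ) T, ∀ s ∈ Set.Icc (0 : ℝ) T,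
      s ≤ u → u ≤ t → ‖B t s - B t u - B u s‖ ≤ A * (t-s)^μ)
    (n : ℕ) : ∀ (y : ℕ → ℝ), Monotone y → (∀ k, y k ∈ Set.Icc (0:ℝ) T) →
      ‖B (y n) (y 0) - ∑ k ∈ Finset.range n, B (y (k+1)) (y k)‖
        ≤ (2 * A * (2:ℝ)^μ / ((2:ℝ)^μ - 2)) * (y n - y 0)^μ := by
  obtain ⟨h0, h2⟩ := sew_r_lt μ hμ
  set P := (2:ℝ)^μ with hP
  have hP2 : 0 < P - 2 := by linarith
  have hKnn : 0 ≤ 2 * A * P / (P - 2) := by positivity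
  induction n using Nat.strong_induction_on with
  | _ n ih =>
  intro y hy hyI
  rcases Nat.eq_zero_or_pos n with rfl | hn
  · simp [hdiag _ (hyI 0)]
    rw [Real.zero_rpow (by linarith)]; simp
  obtain ⟨p, hpn, hp1, hp2⟩ := sew_pick n hn y (hy (Nat.zero_le n))
  have m1 : y 0 ≤ y p := hy (Nat.zero_le p)
  have m2 : y p ≤ y (p+1) := hy (Nat.le_succ p)
  have m3 : y (p+1) ≤ y n := hy hpn
  have e1 := ih p hpn y hy hyI
  obtain ⟨q, rfl⟩ : ∃ q, n = (p+1) + q := ⟨n - (p+1), by omega⟩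
  have e2 := ih q (by omega) (fun k => y (p+1+k)) (fun a b hab => hy (by omega)) (fun k => hyI _)
  have d1 := hB _ (hyI (p+1+q)) _ (hyI p) _ (hyI 0) m1 (m2.trans m3)
  have d2 := hB _ (hyI (p+1+q)) _ (hyI (p+1)) _ (hyI p) m2 m3
  rw [Finset.sum_range_add, Finset.sum_range_succ]
  simp only [add_zero] at e2
  have hsum : ∑ k ∈ Finset.range q, B (y (p+1+(k+1))) (y (p+1+k))
      = ∑ k ∈ Finset.range q, B (y (p+1+k+1)) (y (p+1+k)) := rfl
  rw [hsum] at e2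
  set L := y (p+1+q) - y 0 with hL
  have hL0 : 0 ≤ L := by linarith
  have e1' : (y p - y 0)^μ ≤ L^μ / P := by
    rw [hP, ← sew_half μ L hL0]
    exact Real.rpow_le_rpow (by linarith) hp1 (by linarith)
  have e2' : (y (p+1+q) - y (p+1))^μ ≤ L^μ / P := by
    rw [hP, ← sew_half μ L hL0]
    exact Real.rpow_le_rpow (by linarith) hp2 (by linarith)
  have d2' : (y (p+1+q) - y p)^μ ≤ L^μ :=
    Real.rpow_le_rpow (by linarith) (by linarith) (by linarith)
  have e1'' := e1.trans (mul_le_mul_of_nonneg_left e1' hKnn)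
  have e2'' := e2.trans (mul_le_mul_of_nonneg_left e2' hKnn)
  have d2'' := d2.trans (mul_le_mul_of_nonneg_left d2' hA)
  have split : B (y (p+1+q)) (y 0) - (∑ k ∈ Finset.range p, B (y (k+1)) (y k)
        + B (y (p+1)) (y p) + ∑ k ∈ Finset.range q, B (y (p+1+k+1)) (y (p+1+k)))
      = (B (y (p+1+q)) (y 0) - B (y (p+1+q)) (y p) - B (y p) (y 0))
        + (B (y (p+1+q)) (y p) - B (y (p+1+q)) (y (p+1)) - B (y (p+1)) (y p))
        + (B (y p) (y 0) - ∑ k ∈ Finset.range p, B (y (k+1)) (y k))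
        + (B (y (p+1+q)) (y (p+1)) - ∑ k ∈ Finset.range q, B (y (p+1+k+1)) (y (p+1+k))) := by
    abel
  rw [split]
  refine (norm_add₄_le.trans
    (add_le_add (add_le_add (add_le_add d1 d2'') e1'') e2'')).trans (le_of_eq ?_)
  field_simp
  ring

lemma sew_sum_double {V : Type u} [AddCommGroup V] (F : ℕ → V) (m : ℕ) :
    ∑ k ∈ Finset.range (2*m), F k = ∑ k ∈ Finset.range m, (F (2*k) + F (2*k+1)) := by
  induction m with
  | zero => simp
  | succ m ih =>
    rw [show 2*(m+1) = 2*m+1+1 by ring, Finset.sum_range_succ, Finset.sum_range_succ, ih,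
      Finset.sum_range_succ]
    abel

lemma sew_mesh (T μ A : ℝ) (hT : 0 < T) (n : ℕ) :
    ((2^n : ℕ) : ℝ) * (A * (T/2^n)^μ) = A * T^μ * (2/(2:ℝ)^μ)^n := by
  rw [Real.div_rpow hT.le (by positivity), ← Real.rpow_pow_comm (by norm_num), div_pow]
  push_cast
  ring

lemma sew_clamp {V : Type u} [NormedAddCommGroup V] (T μ A : ℝ) (hA : 0 ≤ A) (B : ℝ → ℝ → V)
    (hdiag : ∀ t ∈ Set.Icc (0 : ℝ) T, B t t = 0)
    (hb : ∀ t ∈ Set.Icc (0 : ℝ) T, ∀ u ∈ Set.Icc (0 : ℝ) T, ∀ s ∈ Set.Icc (0 : ℝ) T,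
      ∀ L : ℝ, |u-s| ≤ L → |t-u| ≤ L → ‖B t s - B t u - B u s‖ ≤ A * L^μ)
    (a b d t s : ℝ) (ha : a ∈ Set.Icc (0 : ℝ) T) (hbI : b ∈ Set.Icc (0 : ℝ) T) (hab : a ≤ b)
    (hd : b - a ≤ d) (ht : t ∈ Set.Icc (0 : ℝ) T) (hs : s ∈ Set.Icc (0 : ℝ) T) (hst : s ≤ t) :
    ‖B (min b t) (min a t) - B (min b s) (min a s) - B (max s (min b t)) (max s (min a t))‖
      ≤ A * d^μ := by
  have hd0 : 0 ≤ d := by linarith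
  have hnn : 0 ≤ A * d^μ := by positivity
  rcases le_or_gt s a with h1 | h1
  · rw [min_eq_right (h1.trans hab), min_eq_right h1, hdiag s hs,
      max_eq_right (le_min (h1.trans hab) hst), max_eq_right (le_min h1 hst)]
    simpa using hnn
  rcases le_or_gt b s with h2 | h2
  · rw [min_eq_left (h2.trans hst), min_eq_left (hab.trans (h2.trans hst)), min_eq_left h2,
      min_eq_left (hab.trans h2), max_eq_left h2, max_eq_left (hab.trans h2), hdiag s hs]
    simpa using hnn
  · have hsm : s ≤ min b t := le_min h2.le hst
    have hmb : min b t ≤ b := min_le_left _ _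
    rw [min_eq_left (h1.le.trans hst), min_eq_right h2.le, min_eq_left h1.le, max_eq_right hsm,
      max_eq_left h1.le]
    have hmI : min b t ∈ Set.Icc (0:ℝ) T := ⟨hs.1.trans hsm, hmb.trans hbI.2⟩
    have := hb _ hmI s hs a ha d (by rw [abs_of_nonneg] <;> linarith)
      (by rw [abs_of_nonneg] <;> linarith)
    rwa [sub_right_comm] at this

lemma sew_exists {V : Type u} [NormedAddCommGroup V] [CompleteSpace V]
    (T μ A : ℝ) (hT : 0 < T) (hμ : 1 < μ) (hA : 0 ≤ A) (B : ℝ → ℝ → V)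
    (hdiag : ∀ t ∈ Set.Icc (0 : ℝ) T, B t t = 0)
    (hb : ∀ t ∈ Set.Icc (0 : ℝ) T, ∀ u ∈ Set.Icc (0 : ℝ) T, ∀ s ∈ Set.Icc (0 : ℝ) T,
      ∀ L : ℝ, |u-s| ≤ L → |t-u| ≤ L → ‖B t s - B t u - B u s‖ ≤ A * L^μ) :
    ∃ (f : ℝ → V) (K : ℝ), 0 ≤ K ∧ ∀ t ∈ Set.Icc (0 : ℝ) T, ∀ s ∈ Set.Icc (0 : ℝ) T,
      ‖B t s - (f t - f s)‖ ≤ K * |t-s|^μ := by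
  obtain ⟨h0, h2⟩ := sew_r_lt μ hμ
  set g : ℕ → ℕ → ℝ := fun n k => T * (min k (2^n) : ℕ) / 2^n with hg
  have gmono : ∀ n, Monotone (g n) := by
    intro n a b hab
    simp only [hg]
    have : min a (2^n) ≤ min b (2^n) := min_le_min_right _ hab
    gcongr
  have gzero : ∀ n, g n 0 = 0 := by intro n; simp [hg]
  have gtop : ∀ n, g n (2^n) = T := by
    intro n; simp only [hg, min_self]; push_cast; field_simp
  have gI : ∀ n k, g n k ∈ Set.Icc (0:ℝ) T := by
    intro n k
    refine ⟨by rw [← gzero n]; exact gmono n (Nat.zero_le k), ?_⟩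
    simp only [hg]
    rw [div_le_iff₀ (by positivity)]
    have : ((min k (2^n) : ℕ):ℝ) ≤ ((2^n : ℕ) : ℝ) := by exact_mod_cast min_le_right _ _
    push_cast at this
    push_cast
    gcongr
  have gstep : ∀ n k, g n (k+1) - g n k ≤ T / 2^n := by
    intro n k
    simp only [hg]
    have : ((min (k+1) (2^n) : ℕ):ℝ) ≤ (min k (2^n) : ℕ) + 1 := by
      have : min (k+1) (2^n) ≤ min k (2^n) + 1 := by omega
      exact_mod_cast this
    rw [← sub_div, ← mul_sub]
    have h3 : T * (((min (k+1) (2^n) : ℕ):ℝ) - (min k (2^n) : ℕ)) ≤ T := by nlinarith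
    gcongr
  have gdouble : ∀ n k, g (n+1) (2*k) = g n k := by
    intro n k
    simp only [hg]
    have : min (2*k) (2^(n+1)) = 2 * min k (2^n) := by rw [pow_succ]; omega
    rw [this, pow_succ]
    push_cast
    field_simp
  set F : ℕ → ℝ → V := fun n t =>
    ∑ k ∈ Finset.range (2^n), B (min (g n (k+1)) t) (min (g n k) t) with hF
  have minI : ∀ x ∈ Set.Icc (0:ℝ) T, ∀ t ∈ Set.Icc (0:ℝ) T, min x t ∈ Set.Icc (0:ℝ) T := by
    intro x hx t ht
    exact ⟨le_min hx.1 ht.1, (min_le_left _ _).trans hx.2⟩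
  have Fstep : ∀ t ∈ Set.Icc (0:ℝ) T, ∀ n, dist (F n t) (F (n+1) t)
      ≤ A * T^μ * (2/(2:ℝ)^μ)^n := by
    intro t ht n
    rw [dist_eq_norm, ← sew_mesh T μ A hT n]
    simp only [hF]
    rw [show (2:ℕ)^(n+1) = 2 * 2^n by ring, sew_sum_double, ← Finset.sum_sub_distrib]
    refine (norm_sum_le_of_le _ (f := _) (n := fun _ => A * (T/2^n)^μ) ?_).trans (le_of_eq ?_)
    · intro k _
      have ea : g (n+1) (2*k) = g n k := gdouble n k
      have eb : g (n+1) (2*k+1+1) = g n (k+1) := gdouble n (k+1)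
      rw [ea, eb]
      have ma : g n k ≤ g (n+1) (2*k+1) := by rw [← ea]; exact gmono _ (by omega)
      have mb : g (n+1) (2*k+1) ≤ g n (k+1) := by rw [← eb]; exact gmono _ (by omega)
      have hst := gstep n k
      have := hb _ (minI _ (gI n (k+1)) t ht) _ (minI _ (gI (n+1) (2*k+1)) t ht)
        _ (minI _ (gI n k) t ht) (T/2^n)
        ((abs_min_sub_min_le_max _ _ _ _).trans (by
          rw [sub_self, abs_zero, abs_of_nonneg (by linarith)]
          exact max_le (by linarith) (by positivity)))
        ((abs_min_sub_min_le_max _ _ _ _).trans (by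
          rw [sub_self, abs_zero, abs_of_nonneg (by linarith)]
          exact max_le (by linarith) (by positivity)))
      refine le_trans (le_of_eq ?_) this
      congr 1
      abel
    · simp
  have hr1 : 2/(2:ℝ)^μ < 1 := by rw [div_lt_one h0]; exact h2
  have hlim : ∀ t, ∃ l, t ∈ Set.Icc (0:ℝ) T →
      Filter.Tendsto (fun n => F n t) Filter.atTop (nhds l) := by
    intro t
    by_cases ht : t ∈ Set.Icc (0:ℝ) T
    · obtain ⟨l, hl⟩ := cauchySeq_tendsto_of_complete
        (cauchySeq_of_le_geometric _ _ hr1 (Fstep t ht))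
      exact ⟨l, fun _ => hl⟩
    · exact ⟨0, fun h => absurd h ht⟩
  choose f hf using hlim
  set K := 2 * A * (2:ℝ)^μ / ((2:ℝ)^μ - 2) with hK
  have hP2 : 0 < (2:ℝ)^μ - 2 := by linarith
  have hK0 : 0 ≤ K := by positivity
  have ordered : ∀ t ∈ Set.Icc (0 : ℝ) T, ∀ s ∈ Set.Icc (0 : ℝ) T, s ≤ t →
      ‖B t s - (f t - f s)‖ ≤ K * (t-s)^μ := by
    intro t ht s hs hst
    have bound : ∀ n, ‖B t s - (F n t - F n s)‖
        ≤ K * (t-s)^μ + A * T^μ * (2/(2:ℝ)^μ)^n := by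
      intro n
      set y : ℕ → ℝ := fun k => max s (min (g n k) t) with hy
      have ymono : Monotone y := fun a b hab =>
        max_le_max_left _ (min_le_min_right _ (gmono n hab))
      have yI : ∀ k, y k ∈ Set.Icc (0:ℝ) T := fun k =>
        ⟨hs.1.trans (le_max_left _ _), max_le hs.2 ((min_le_right _ _).trans ht.2)⟩
      have y0 : y 0 = s := by
        simp only [hy, gzero]
        exact max_eq_left ((min_le_left _ _).trans hs.1)
      have yN : y (2^n) = t := by
        simp only [hy, gtop]
        rw [min_eq_right ht.2, max_eq_right hst]
      have yo := sew_young T μ hμ B A hA hdiag (by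
        intro t ht u hu s hs hsu hut
        exact hb t ht u hu s hs _ (by rw [abs_of_nonneg] <;> linarith)
          (by rw [abs_of_nonneg] <;> linarith)) (2^n) y ymono yI
      rw [y0, yN] at yo
      have e : ‖F n t - F n s - ∑ k ∈ Finset.range (2^n), B (y (k+1)) (y k)‖
          ≤ A * T^μ * (2/(2:ℝ)^μ)^n := by
        rw [← sew_mesh T μ A hT n]
        simp only [hF]
        rw [← Finset.sum_sub_distrib, ← Finset.sum_sub_distrib]
        refine (norm_sum_le_of_le _ (f := _) (n := fun _ => A * (T/2^n)^μ) ?_).trans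
          (le_of_eq ?_)
        · intro k _
          exact sew_clamp T μ A hA B hdiag hb _ _ _ t s (gI n k) (gI n (k+1))
            (gmono n (Nat.le_succ k)) (gstep n k) ht hs hst
        · simp
      have := norm_sub_le (B t s - ∑ k ∈ Finset.range (2^n), B (y (k+1)) (y k))
        (F n t - F n s - ∑ k ∈ Finset.range (2^n), B (y (k+1)) (y k))
      rw [sub_sub_sub_cancel_right] at this
      exact this.trans (add_le_add yo e)
    have l1 : Filter.Tendsto (fun n => ‖B t s - (F n t - F n s)‖) Filter.atTop
        (nhds ‖B t s - (f t - f s)‖) :=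
      (((hf t ht).sub (hf s hs)).const_sub _).norm
    have l2 : Filter.Tendsto (fun n : ℕ => K * (t-s)^μ + A * T^μ * (2/(2:ℝ)^μ)^n) Filter.atTop
        (nhds (K * (t-s)^μ + A * T^μ * 0)) :=
      ((tendsto_pow_atTop_nhds_zero_of_lt_one (by positivity) hr1).const_mul _).const_add _
    have := le_of_tendsto_of_tendsto' l1 l2 bound
    simpa using this
  refine ⟨f, K + A, by positivity, ?_⟩
  intro t ht s hs
  rcases le_total s t with hst | hst
  · rw [abs_of_nonneg (by linarith)]
    have h3 : 0 ≤ t - s := by linarith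
    refine (ordered t ht s hs hst).trans ?_
    have : 0 ≤ (t-s)^μ := by positivity
    nlinarith
  · have o := ordered s hs t ht hst
    have d := hb t ht s hs t ht |t-s| (by rw [abs_sub_comm]) le_rfl
    rw [abs_sub_comm, abs_of_nonneg (show 0 ≤ s - t by linarith)] at d ⊢
    have e : B t s - (f t - f s) = -(B s t - (f s - f t)) - (B t t - B t s - B s t) := by
      rw [hdiag t ht]; abel
    rw [e]
    refine (norm_sub_le _ _).trans ?_
    rw [norm_neg, add_mul]
    exact add_le_add o d

/-- `M` is a solution of the sewing problem for `h`. -/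
def SewSol (T : ℝ) {V : Type u} [NormedAddCommGroup V] (h : ℝ → ℝ → ℝ → V)
    (M : ℝ → ℝ → V) : Prop :=
  MemC2 T M ∧
    (∀ t ∈ Set.Icc (0 : ℝ) T, ∀ u ∈ Set.Icc (0 : ℝ) T, ∀ s ∈ Set.Icc (0 : ℝ) T,
      delta2 M t u s = h t u s) ∧ C2plus T M

lemma sew_decomp_bound {V : Type u} [NormedAddCommGroup V] (T μ : ℝ)
    (h : ℝ → ℝ → ℝ → V) (n : ℕ) (hs : Fin n → ℝ → ℝ → ℝ → V) (ρ K : Fin n → ℝ)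
    (hD : DecompBound T μ h n hs ρ K) :
    ∀ t ∈ Set.Icc (0 : ℝ) T, ∀ u ∈ Set.Icc (0 : ℝ) T, ∀ s ∈ Set.Icc (0 : ℝ) T,
      ∀ L : ℝ, |u-s| ≤ L → |t-u| ≤ L → ‖h t u s‖ ≤ (∑ i, K i) * L^μ := by
  obtain ⟨hρ, hK, _, hsum, hbd⟩ := hD
  intro t ht u hu s hs' L h1 h2
  have hL : 0 ≤ L := (abs_nonneg _).trans h1
  rw [hsum t ht u hu s hs', Finset.sum_mul]
  refine norm_sum_le_of_le _ ?_
  intro i _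
  have hi := hρ i
  have hi1 : 0 < ρ i := hi.1
  have hi2 : 0 < μ - ρ i := sub_pos.2 hi.2
  refine (hbd i t ht u hu s hs').trans ?_
  have e : L^μ = L^(ρ i) * L^(μ - ρ i) := by
    rw [← Real.rpow_add_of_nonneg hL hi1.le hi2.le]; congr 1; ring
  rw [e, mul_assoc]
  have := hK i
  gcongr

lemma sew_pow_le (T x ν ν' : ℝ) (hx : 0 ≤ x) (hxT : x ≤ T) (hν : 0 ≤ ν) (h : ν ≤ ν') :
    x^ν' ≤ T^(ν'-ν) * x^ν := by
  have e : x^ν' = x^(ν'-ν) * x^ν := by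
    rw [← Real.rpow_add_of_nonneg hx (by linarith) hν]; congr 1; ring
  rw [e]
  have : x^(ν'-ν) ≤ T^(ν'-ν) := Real.rpow_le_rpow hx hxT (by linarith)
  gcongr

lemma sew_abs_le {T t s : ℝ} (ht : t ∈ Set.Icc (0:ℝ) T) (hs : s ∈ Set.Icc (0:ℝ) T) :
    |t - s| ≤ T := by
  rw [abs_le]
  obtain ⟨a, b⟩ := ht
  obtain ⟨c, d⟩ := hs
  constructor <;> linarith

lemma sew_C2_lower {V : Type u} [NormedAddCommGroup V] (T : ℝ) (hT : 0 < T) (M : ℝ → ℝ → V)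
    (ν ν' K : ℝ) (hν : 0 ≤ ν) (h : ν ≤ ν') (hK : 0 ≤ K)
    (hM : ∀ t ∈ Set.Icc (0 : ℝ) T, ∀ s ∈ Set.Icc (0 : ℝ) T, ‖M t s‖ ≤ K * |t - s| ^ ν') :
    0 ≤ K * T^(ν'-ν) ∧ ∀ t ∈ Set.Icc (0 : ℝ) T, ∀ s ∈ Set.Icc (0 : ℝ) T,
      ‖M t s‖ ≤ K * T^(ν'-ν) * |t - s| ^ ν := by
  refine ⟨by positivity, fun t ht s hs => (hM t ht s hs).trans ?_⟩
  rw [mul_assoc]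
  exact mul_le_mul_of_nonneg_left
    (sew_pow_le T _ ν ν' (abs_nonneg _) (sew_abs_le ht hs) hν h) hK

lemma sew_C2_add {V : Type u} [NormedAddCommGroup V] (T : ℝ) (hT : 0 < T) (M M' : ℝ → ℝ → V)
    (h : C2plus T M) (h' : C2plus T M') : C2plus T (fun t s => M t s + M' t s) := by
  obtain ⟨ν, hν, K, hK, hM⟩ := h
  obtain ⟨ν', hν', K', hK', hM'⟩ := h'
  have hm : 1 < min ν ν' := lt_min hν hν'
  obtain ⟨a, b⟩ := sew_C2_lower T hT M (min ν ν') ν K (by linarith) (min_le_left _ _) hK hM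
  obtain ⟨a', b'⟩ := sew_C2_lower T hT M' (min ν ν') ν' K' (by linarith) (min_le_right _ _) hK' hM'
  refine ⟨min ν ν', hm, _, add_nonneg a a', fun t ht s hs => ?_⟩
  rw [add_mul]
  exact (norm_add_le _ _).trans (add_le_add (b t ht s hs) (b' t ht s hs))

lemma sew_C2_smul {V : Type u} [NormedAddCommGroup V] [NormedSpace ℝ V] (T : ℝ) (r : ℝ)
    (M : ℝ → ℝ → V) (h : C2plus T M) : C2plus T (fun t s => r • M t s) := by
  obtain ⟨ν, hν, K, hK, hM⟩ := h
  refine ⟨ν, hν, |r| * K, by positivity, fun t ht s hs => ?_⟩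
  rw [norm_smul, mul_assoc, Real.norm_eq_abs]
  exact mul_le_mul_of_nonneg_left (hM t ht s hs) (abs_nonneg _)

lemma sew_unique {V : Type u} [NormedAddCommGroup V] [NormedSpace ℝ V] (T : ℝ) (hT : 0 < T)
    (h : ℝ → ℝ → ℝ → V)
    (M M' : ℝ → ℝ → V) (hM : SewSol T h M) (hM' : SewSol T h M') :
    ∀ t ∈ Set.Icc (0 : ℝ) T, ∀ s ∈ Set.Icc (0 : ℝ) T, M' t s = M t s := by
  obtain ⟨ν, hν, K, hK, hD⟩ := sew_C2_add T hT _ _ hM'.2.2 (sew_C2_smul T (-1) _ hM.2.2)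
  intro t ht s hs
  have := sew_sharp T ν hν (fun t s => M' t s + (-1:ℝ) • M t s) 0 K (by
    intro t ht s hs
    have hm := sew_mid ht hs
    have e1 := hM.2.1 t ht _ hm s hs
    have e2 := hM'.2.1 t ht _ hm s hs
    rw [← e2] at e1
    simp only [delta2] at e1
    rw [zero_mul, norm_le_zero_iff]
    have := sub_eq_zero.2 e1.symm
    simp only [neg_smul, one_smul]
    rw [← this]
    abel) hD t ht s hs
  simp only [mul_zero, zero_mul, norm_le_zero_iff, neg_smul, one_smul] at this
  rwa [← sub_eq_add_neg, sub_eq_zero] at this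

lemma sew_main_exists {V : Type u} [NormedAddCommGroup V] [CompleteSpace V]
    (T μ : ℝ) (hT : 0 < T) (hμ : 1 < μ) (h : ℝ → ℝ → ℝ → V) (hC : MemC3 T h) (hZ : ZD3 T h)
    (n : ℕ) (hs : Fin n → ℝ → ℝ → ℝ → V) (ρ K : Fin n → ℝ)
    (hD : DecompBound T μ h n hs ρ K) :
    ∃ M, SewSol T h M ∧ ∃ C, 0 ≤ C ∧ ∀ t ∈ Set.Icc (0 : ℝ) T, ∀ s ∈ Set.Icc (0 : ℝ) T,
      ‖M t s‖ ≤ C * |t - s| ^ μ := by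
  have hb := sew_decomp_bound T μ h n hs ρ K hD
  have hA : 0 ≤ ∑ i, K i := Finset.sum_nonneg (fun i _ => hD.2.1 i)
  have h0 : (0:ℝ) ∈ Set.Icc (0:ℝ) T := ⟨le_rfl, hT.le⟩
  have hB : ∀ t ∈ Set.Icc (0 : ℝ) T, ∀ u ∈ Set.Icc (0 : ℝ) T, ∀ s ∈ Set.Icc (0 : ℝ) T,
      (-h t s 0) - (-h t u 0) - (-h u s 0) = h t u s := by
    intro t ht u hu s hs
    have := hZ t ht u hu s hs 0 h0
    rw [sub_eq_zero] at this
    rw [← this]; abel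
  obtain ⟨f, C, hC0, hf⟩ := sew_exists T μ _ hT hμ hA (fun t s => -h t s 0)
    (fun t ht => by simp [hC t ht t ht 0 h0 (Or.inl rfl)])
    (fun t ht u hu s hs L h1 h2 => by
      simp only [hB t ht u hu s hs]; exact hb t ht u hu s hs L h1 h2)
  refine ⟨fun t s => -h t s 0 - (f t - f s), ⟨?_, ?_, μ, hμ, C, hC0, hf⟩, C, hC0, hf⟩
  · intro t ht
    simp [hC t ht t ht 0 h0 (Or.inl rfl)]
  · intro t ht u hu s hs
    rw [← hB t ht u hu s hs]
    simp only [delta2]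
    abel

lemma sew_bound {V : Type u} [NormedAddCommGroup V] [NormedSpace ℝ V] [CompleteSpace V]
    (T μ : ℝ) (hT : 0 < T) (hμ : 1 < μ) (h : ℝ → ℝ → ℝ → V) (hC : MemC3 T h) (hZ : ZD3 T h)
    (n : ℕ) (hs : Fin n → ℝ → ℝ → ℝ → V) (ρ K : Fin n → ℝ)
    (hD : DecompBound T μ h n hs ρ K) (M : ℝ → ℝ → V) (hM : SewSol T h M) :
    ∀ t ∈ Set.Icc (0 : ℝ) T, ∀ s ∈ Set.Icc (0 : ℝ) T,
      ‖M t s‖ ≤ ((2 : ℝ) ^ μ - 2)⁻¹ * (∑ i, K i) * |t - s| ^ μ := by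
  obtain ⟨M', hM', C, _, hC'⟩ := sew_main_exists T μ hT hμ h hC hZ n hs ρ K hD
  refine sew_sharp T μ hμ M _ C ?_ ?_
  · intro t ht s hs'
    have hm := sew_mid ht hs'
    have := hM.2.1 t ht _ hm s hs'
    simp only [delta2] at this
    rw [this]
    exact sew_decomp_bound T μ h n hs ρ K hD t ht _ hm s hs' _ (sew_absmid t s).2.le
      (sew_absmid t s).1.le
  · intro t ht s hs'
    rw [sew_unique T hT h M' M hM' hM t ht s hs']
    exact hC' t ht s hs'

lemma sew_lower {V : Type u} [NormedAddCommGroup V]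
    (T μ μ' : ℝ) (hT : 0 < T) (hμ' : 1 < μ') (hle : μ' ≤ μ) (h : ℝ → ℝ → ℝ → V)
    (n : ℕ) (hs : Fin n → ℝ → ℝ → ℝ → V) (ρ K : Fin n → ℝ)
    (hD : DecompBound T μ h n hs ρ K) :
    ∃ ρ' K', DecompBound T μ' h n hs ρ' K' := by
  obtain ⟨hρ, hK, hC, hsum, hbd⟩ := hD
  have hμ : 0 < μ := by linarith
  have hq1 : μ'/μ ≤ 1 := (div_le_one hμ).2 hle
  have hq0 : 0 < μ'/μ := by positivity
  have hqm : μ'/μ * μ = μ' := by field_simp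
  set q := μ'/μ with hq
  refine ⟨fun i => q * ρ i,
    fun i => K i * (T^(ρ i - q * ρ i) * T^((μ - ρ i) - (μ' - q * ρ i))), ?_, ?_, hC, hsum, ?_⟩
  · intro i
    have := hρ i
    refine ⟨mul_pos hq0 this.1, ?_⟩
    show q * ρ i < μ'
    rw [← hqm]
    exact mul_lt_mul_of_pos_left this.2 hq0
  · intro i
    have := hK i
    positivity
  · intro i t ht u hu s hs'
    have h1 := (hρ i).1
    have h2 : 0 < μ - ρ i := sub_pos.2 (hρ i).2
    have e : μ' - q * ρ i = q * (μ - ρ i) := by rw [← hqm]; ring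
    have a1 := sew_pow_le T |u-s| (q * ρ i) (ρ i) (abs_nonneg _) (sew_abs_le hu hs')
      (by positivity) (by nlinarith)
    have a2 := sew_pow_le T |t-u| (μ' - q * ρ i) (μ - ρ i) (abs_nonneg _) (sew_abs_le ht hu)
      (by rw [e]; positivity) (by rw [e]; nlinarith)
    refine (hbd i t ht u hu s hs').trans ?_
    have hKi := hK i
    calc K i * |u - s| ^ ρ i * |t - u| ^ (μ - ρ i)
        ≤ K i * (T^(ρ i - q * ρ i) * |u-s|^(q * ρ i)) *
          (T^((μ - ρ i) - (μ' - q * ρ i)) * |t-u|^(μ' - q * ρ i)) := by gcongr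
      _ = _ := by ring

lemma sew_decomp_add {V : Type u} [NormedAddCommGroup V] (T μ : ℝ) (h h' : ℝ → ℝ → ℝ → V)
    (n : ℕ) (hs : Fin n → ℝ → ℝ → ℝ → V) (ρ K : Fin n → ℝ)
    (hD : DecompBound T μ h n hs ρ K)
    (n' : ℕ) (hs' : Fin n' → ℝ → ℝ → ℝ → V) (ρ' K' : Fin n' → ℝ)
    (hD' : DecompBound T μ h' n' hs' ρ' K') :
    DecompBound T μ (fun a b c => h a b c + h' a b c) (n+n') (Fin.append hs hs')
      (Fin.append ρ ρ') (Fin.append K K') := by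
  obtain ⟨a1, a2, a3, a4, a5⟩ := hD
  obtain ⟨b1, b2, b3, b4, b5⟩ := hD'
  refine ⟨?_, ?_, ?_, ?_, ?_⟩
  · intro i
    refine Fin.addCases (fun i => ?_) (fun i => ?_) i
    · simpa using a1 i
    · simpa using b1 i
  · intro i
    refine Fin.addCases (fun i => ?_) (fun i => ?_) i
    · simpa using a2 i
    · simpa using b2 i
  · intro i
    refine Fin.addCases (fun i => ?_) (fun i => ?_) i
    · simpa using a3 i
    · simpa using b3 i
  · intro t ht u hu s hs
    rw [Fin.sum_univ_add]
    simp only [Fin.append_left, Fin.append_right]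
    rw [a4 t ht u hu s hs, b4 t ht u hu s hs]
  · intro i
    refine Fin.addCases (fun i => ?_) (fun i => ?_) i
    · simpa only [Fin.append_left] using a5 i
    · simpa only [Fin.append_right] using b5 i

lemma sew_ZC_add {V : Type u} [NormedAddCommGroup V] (T : ℝ) (hT : 0 < T)
    (h h' : ℝ → ℝ → ℝ → V) (H : ZC1p T h) (H' : ZC1p T h') :
    ZC1p T (fun a b c => h a b c + h' a b c) := by
  obtain ⟨hC, hZ, μ, hμ, n, hs, ρ, K, hD⟩ := H
  obtain ⟨hC', hZ', μ', hμ', n', hs', ρ', K', hD'⟩ := H'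
  have hm : 1 < min μ μ' := lt_min hμ hμ'
  obtain ⟨σ, L, hE⟩ := sew_lower T μ _ hT hm (min_le_left _ _) h n hs ρ K hD
  obtain ⟨σ', L', hE'⟩ := sew_lower T μ' _ hT hm (min_le_right _ _) h' n' hs' ρ' K' hD'
  refine ⟨?_, ?_, min μ μ', hm, _, _, _, _, sew_decomp_add T _ h h' n hs σ L hE n' hs' σ' L' hE'⟩
  · intro t ht u hu s hs hh
    simp [hC t ht u hu s hs hh, hC' t ht u hu s hs hh]
  · intro t ht u hu v hv s hs
    have e := hZ t ht u hu v hv s hs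
    have e' := hZ' t ht u hu v hv s hs
    beta_reduce
    rw [← add_zero (0:V)]
    nth_rewrite 1 [← e]
    rw [← e']
    abel

lemma sew_ZC_smul {V : Type u} [NormedAddCommGroup V] [NormedSpace ℝ V] (T : ℝ) (r : ℝ)
    (h : ℝ → ℝ → ℝ → V) (H : ZC1p T h) :
    ZC1p T (fun a b c => r • h a b c) := by
  obtain ⟨hC, hZ, μ, hμ, n, hs, ρ, K, a1, a2, a3, a4, a5⟩ := H
  refine ⟨?_, ?_, μ, hμ, n, fun i a b c => r • hs i a b c, ρ, fun i => |r| * K i, a1, ?_, ?_, ?_, ?_⟩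
  · intro t ht u hu s hs hh
    simp [hC t ht u hu s hs hh]
  · intro t ht u hu v hv s hs
    have e := hZ t ht u hu v hv s hs
    simp only [← smul_sub, ← smul_add]
    rw [e, smul_zero]
  · intro i
    have := a2 i
    positivity
  · intro i t ht u hu s hs hh
    simp [a3 i t ht u hu s hs hh]
  · intro t ht u hu s hs
    simp only []
    rw [a4 t ht u hu s hs, Finset.smul_sum]
  · intro i t ht u hu s hs
    rw [norm_smul, Real.norm_eq_abs, mul_assoc, mul_assoc]
    have := a5 i t ht u hu s hs
    rw [mul_assoc] at this
    exact mul_le_mul_of_nonneg_left this (abs_nonneg _)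

/-- The sewing map: every `h ∈ ZC₃^μ(V)`, `μ > 1`, has a unique preimage
`M ∈ C₂^{1+}(V)` under `δ`, with `‖M‖_μ ≤ (2^μ − 2)⁻¹ ‖h‖_μ`; consequently there is
a unique linear map `Λ : ZC₃^{1+}(V) → C₂^{1+}(V)` with `δ ∘ Λ = Id`, satisfying the
same bound on `ZC₃^μ(V)`. -/
theorem stmt1 (T : ℝ) (hT : 0 < T) (V : Type u) [NormedAddCommGroup V]
    [NormedSpace ℝ V] [CompleteSpace V] (μ : ℝ) (hμ : 1 < μ) :
    (∀ h : ℝ → ℝ → ℝ → V, MemC3 T h → ZD3 T h →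
      (∃ n hs ρ K, DecompBound T μ h n hs ρ K) →
      ∃ Mf : ℝ → ℝ → V,
        (MemC2 T Mf ∧
          (∀ t ∈ Set.Icc (0 : ℝ) T, ∀ u ∈ Set.Icc (0 : ℝ) T, ∀ s ∈ Set.Icc (0 : ℝ) T,
            delta2 Mf t u s = h t u s) ∧ C2plus T Mf) ∧
        (∀ Mf' : ℝ → ℝ → V,
          (MemC2 T Mf' ∧
            (∀ t ∈ Set.Icc (0 : ℝ) T, ∀ u ∈ Set.Icc (0 : ℝ) T, ∀ s ∈ Set.Icc (0 : ℝ) T,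
              delta2 Mf' t u s = h t u s) ∧ C2plus T Mf') →
          ∀ t ∈ Set.Icc (0 : ℝ) T, ∀ s ∈ Set.Icc (0 : ℝ) T, Mf' t s = Mf t s) ∧
        (∀ (n : ℕ) (hs : Fin n → ℝ → ℝ → ℝ → V) (ρ K : Fin n → ℝ),
          DecompBound T μ h n hs ρ K →
          ∀ t ∈ Set.Icc (0 : ℝ) T, ∀ s ∈ Set.Icc (0 : ℝ) T,
            ‖Mf t s‖ ≤ ((2 : ℝ) ^ μ - 2)⁻¹ * (∑ i, K i) * |t - s| ^ μ)) ∧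
    (∃ Lam : (ℝ → ℝ → ℝ → V) → ℝ → ℝ → V,
      (∀ h, ZC1p T h →
        MemC2 T (Lam h) ∧
        (∀ t ∈ Set.Icc (0 : ℝ) T, ∀ u ∈ Set.Icc (0 : ℝ) T, ∀ s ∈ Set.Icc (0 : ℝ) T,
          delta2 (Lam h) t u s = h t u s) ∧ C2plus T (Lam h)) ∧
      (∀ h h', ZC1p T h → ZC1p T h' →
        ∀ t ∈ Set.Icc (0 : ℝ) T, ∀ s ∈ Set.Icc (0 : ℝ) T,
          Lam (fun a b c => h a b c + h' a b c) t s = Lam h t s + Lam h' t s) ∧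
      (∀ (r : ℝ) (h : ℝ → ℝ → ℝ → V), ZC1p T h →
        ∀ t ∈ Set.Icc (0 : ℝ) T, ∀ s ∈ Set.Icc (0 : ℝ) T,
          Lam (fun a b c => r • h a b c) t s = r • Lam h t s) ∧
      (∀ (h : ℝ → ℝ → ℝ → V) (n : ℕ) (hs : Fin n → ℝ → ℝ → ℝ → V) (ρ K : Fin n → ℝ),
        MemC3 T h → ZD3 T h → DecompBound T μ h n hs ρ K →
        ∀ t ∈ Set.Icc (0 : ℝ) T, ∀ s ∈ Set.Icc (0 : ℝ) T,
          ‖Lam h t s‖ ≤ ((2 : ℝ) ^ μ - 2)⁻¹ * (∑ i, K i) * |t - s| ^ μ) ∧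
      (∀ Lam' : (ℝ → ℝ → ℝ → V) → ℝ → ℝ → V,
        (∀ h, ZC1p T h →
          MemC2 T (Lam' h) ∧
          (∀ t ∈ Set.Icc (0 : ℝ) T, ∀ u ∈ Set.Icc (0 : ℝ) T, ∀ s ∈ Set.Icc (0 : ℝ) T,
            delta2 (Lam' h) t u s = h t u s) ∧ C2plus T (Lam' h)) →
        ∀ h, ZC1p T h → ∀ t ∈ Set.Icc (0 : ℝ) T, ∀ s ∈ Set.Icc (0 : ℝ) T,
          Lam' h t s = Lam h t s)) := by
  have hex : ∀ h : ℝ → ℝ → ℝ → V, ∃ M, ZC1p T h → SewSol T h M := by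
    intro h
    by_cases H : ZC1p T h
    · obtain ⟨hC, hZ, μ', hμ', n, hs, ρ, K, hD⟩ := H
      obtain ⟨M, hM, _⟩ := sew_main_exists T μ' hT hμ' h hC hZ n hs ρ K hD
      exact ⟨M, fun _ => hM⟩
    · exact ⟨0, fun h => absurd h H⟩
  choose Lam hLam using hex
  constructor
  · intro h hC hZ hD
    have HZ : ZC1p T h := ⟨hC, hZ, μ, hμ, hD⟩
    exact ⟨Lam h, hLam h HZ, fun M' hM' => sew_unique T hT h _ _ (hLam h HZ) hM',
      fun n hs ρ K hD => sew_bound T μ hT hμ h hC hZ n hs ρ K hD _ (hLam h HZ)⟩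
  · refine ⟨Lam, hLam, ?_, ?_, ?_, ?_⟩
    · intro h h' H H'
      refine sew_unique T hT _ (fun t s => Lam h t s + Lam h' t s) _ ?_
        (hLam _ (sew_ZC_add T hT h h' H H'))
      obtain ⟨a, b, c⟩ := hLam h H
      obtain ⟨a', b', c'⟩ := hLam h' H'
      refine ⟨fun t ht => by simp [a t ht, a' t ht], ?_, sew_C2_add T hT _ _ c c'⟩
      intro t ht u hu s hs
      simp only []
      rw [← b t ht u hu s hs, ← b' t ht u hu s hs]
      simp only [delta2]
      abel
    · intro r h H
      refine sew_unique T hT _ (fun t s => r • Lam h t s) _ ?_ (hLam _ (sew_ZC_smul T r h H))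
      obtain ⟨a, b, c⟩ := hLam h H
      refine ⟨fun t ht => by simp [a t ht], ?_, sew_C2_smul T r _ c⟩
      intro t ht u hu s hs
      simp only []
      rw [← b t ht u hu s hs]
      simp only [delta2, smul_sub]
    · intro h n hs ρ K hC hZ hD
      exact sew_bound T μ hT hμ h hC hZ n hs ρ K hD _
        (hLam h ⟨hC, hZ, μ, hμ, n, hs, ρ, K, hD⟩)
    · intro Lam' hLam' h H
      exact sew_unique T hT h _ _ (hLam h H) (hLam' h H)
end

section
/- (Integration of small increments.) Let μ > 1 and g ∈ C_2(V) with ‖δg‖_μ < ∞. Then there exists F ∈ C_2(V) with δF = 0 and ‖F − g‖_μ ≤ (2^μ − 2)^{−1} ‖δg‖_μ such that for every 0 ≤ s < t ≤ T, F_{ts} is the limit of the Riemann sums Σ_{i=0}^{n−1} g_{t_{i+1} t_i} taken over partitions s = t_0 < t_1 < ⋯ < t_n = t of [s,t] as the mesh tends to zero (i.e. for every ε > 0 there is η > 0 such that every such partition with mesh < η yields a Riemann sum within ε of F_{ts}). -/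
open scoped BigOperators

universe u

variable {V : Type u}


namespace Sew

/-- The norm bound on `δg` used throughout. -/
def DB (T μ K : ℝ) [NormedAddCommGroup V] (g : ℝ → ℝ → V) : Prop :=
  ∀ t ∈ Set.Icc (0 : ℝ) T, ∀ u ∈ Set.Icc (0 : ℝ) T, ∀ s ∈ Set.Icc (0 : ℝ) T, ∀ L : ℝ, 0 < L →
    |u - s| ≤ L → |t - u| ≤ L → ‖delta2 g t u s‖ ≤ K * L ^ μ

theorem db_of_decomp {T μ : ℝ} [NormedAddCommGroup V] {g : ℝ → ℝ → V}
    {n : ℕ} {hs : Fin n → ℝ → ℝ → ℝ → V} {ρ K : Fin n → ℝ}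
    (h : DecompBound T μ (delta2 g) n hs ρ K) : DB T μ (∑ i, K i) g := by
  obtain ⟨hρ, hK, -, heq, hb⟩ := h
  intro t ht u hu s hs' L hL h1 h2
  rw [heq t ht u hu s hs', Finset.sum_mul]
  refine (norm_sum_le _ _).trans (Finset.sum_le_sum fun i _ => ?_)
  refine (hb i t ht u hu s hs').trans ?_
  have hr := hρ i
  have e : L ^ μ = L ^ ρ i * L ^ (μ - ρ i) := by
    rw [← Real.rpow_add hL]; congr 1; ring
  rw [e, ← mul_assoc]
  have := hK i
  have a1 : |u - s| ^ ρ i ≤ L ^ ρ i := Real.rpow_le_rpow (abs_nonneg _) h1 hr.1.le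
  have a2 : |t - u| ^ (μ - ρ i) ≤ L ^ (μ - ρ i) :=
    Real.rpow_le_rpow (abs_nonneg _) h2 (by linarith [hr.2])
  gcongr

/-- Round down to level `n`. -/
noncomputable def rd (n : ℕ) (t : ℝ) : ℝ := (⌊(2:ℝ)^n * t⌋₊ : ℝ) / 2 ^ n

/-- Level `n` approximation. -/
noncomputable def fn [AddCommGroup V] (g : ℝ → ℝ → V) (n : ℕ) (t : ℝ) : V :=
  ∑ k ∈ Finset.range ⌊(2:ℝ)^n * t⌋₊, g (((k:ℝ)+1)/2^n) ((k:ℝ)/2^n) + g t (rd n t)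

/-- Cell defect. -/
noncomputable def cd [AddCommGroup V] (g : ℝ → ℝ → V) (n : ℕ) (k : ℕ) : V :=
  delta2 g (((k:ℝ)+1)/2^n) ((2*(k:ℝ)+1)/2^(n+1)) ((k:ℝ)/2^n)

theorem sum_range_two_mul' [AddCommGroup V] (a : ℕ → V) (m : ℕ) :
    ∑ k ∈ Finset.range (2*m), a k = ∑ k ∈ Finset.range m, (a (2*k) + a (2*k+1)) := by
  induction m with
  | zero => simp
  | succ m ih =>
    rw [Finset.sum_range_succ, ← ih, show 2*(m+1) = 2*m+1+1 by ring, Finset.sum_range_succ,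
      Finset.sum_range_succ]
    abel

theorem floor_half (n : ℕ) (t : ℝ) :
    ⌊(2:ℝ)^(n+1) * t⌋₊ / 2 = ⌊(2:ℝ)^n * t⌋₊ := by
  have := Nat.floor_div_natCast ((2:ℝ)^(n+1) * t) 2
  rw [← this]
  congr 1
  push_cast
  rw [pow_succ]; ring

theorem rd_le {n : ℕ} {t : ℝ} (ht : 0 ≤ t) : rd n t ≤ t := by
  unfold rd
  rw [div_le_iff₀ (by positivity), mul_comm]
  exact Nat.floor_le (by positivity)

theorem rd_nonneg {n : ℕ} {t : ℝ} : 0 ≤ rd n t := by unfold rd; positivity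

theorem lt_rd {n : ℕ} {t : ℝ} : t ≤ rd n t + 1/2^n := by
  unfold rd
  rw [← add_div, le_div_iff₀ (by positivity), mul_comm]
  exact (Nat.lt_floor_add_one _).le

theorem rd_mem {T t : ℝ} {n : ℕ} (ht : t ∈ Set.Icc (0:ℝ) T) : rd n t ∈ Set.Icc (0:ℝ) T :=
  ⟨rd_nonneg, (rd_le ht.1).trans ht.2⟩

theorem rd_mono_level {n : ℕ} {t : ℝ} : rd n t ≤ rd (n+1) t := by
  unfold rd
  rw [div_le_div_iff₀ (by positivity) (by positivity), pow_succ]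
  have h := floor_half n t
  have : 2 * ⌊(2:ℝ)^n * t⌋₊ ≤ ⌊(2:ℝ)^(n+1) * t⌋₊ := by omega
  have h2 : (2:ℝ) * ⌊(2:ℝ)^n * t⌋₊ ≤ ⌊(2:ℝ)^(n+1) * t⌋₊ := by exact_mod_cast this
  have : (0:ℝ) < 2^n := by positivity
  rw [← pow_succ]
  nlinarith [pow_succ (2:ℝ) n]

theorem step [NormedAddCommGroup V] {T t : ℝ} {g : ℝ → ℝ → V} (hg : MemC2 T g)
    (ht : t ∈ Set.Icc (0:ℝ) T) (n : ℕ) :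
    fn g n t - fn g (n+1) t = ∑ k ∈ Finset.range ⌊(2:ℝ)^n * t⌋₊, cd g n k
      + delta2 g t (rd (n+1) t) (rd n t) := by
  have hsum : ∀ m : ℕ, ∑ k ∈ Finset.range m, cd g n k =
      ∑ k ∈ Finset.range m, g (((k:ℝ)+1)/2^n) ((k:ℝ)/2^n) -
      ∑ k ∈ Finset.range (2*m), g (((k:ℝ)+1)/2^(n+1)) ((k:ℝ)/2^(n+1)) := by
    intro m
    rw [sum_range_two_mul', ← Finset.sum_sub_distrib]
    refine Finset.sum_congr rfl fun k _ => ?_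
    unfold cd delta2
    have e1 : ((k:ℝ)+1)/2^n = (((2*k+1 : ℕ) : ℝ)+1)/2^(n+1) := by
      push_cast; rw [pow_succ]; field_simp; ring
    have e2 : (k:ℝ)/2^n = ((2*k : ℕ) : ℝ)/2^(n+1) := by
      push_cast; rw [pow_succ]; field_simp
    rw [e1, e2]
    push_cast
    abel
  rw [hsum]
  have h := floor_half n t
  have hmem := rd_mem (n := n) ht
  unfold fn delta2
  rcases Nat.mod_two_eq_zero_or_one ⌊(2:ℝ)^(n+1) * t⌋₊ with h0 | h0
  · have e : ⌊(2:ℝ)^(n+1) * t⌋₊ = 2 * ⌊(2:ℝ)^n * t⌋₊ := by omega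
    have er : rd (n+1) t = rd n t := by
      unfold rd; rw [e, pow_succ]; push_cast; field_simp
    rw [er, e, hg _ hmem]
    abel
  · have e : ⌊(2:ℝ)^(n+1) * t⌋₊ = 2 * ⌊(2:ℝ)^n * t⌋₊ + 1 := by omega
    have er : rd n t = ((2 * ⌊(2:ℝ)^n * t⌋₊ : ℕ) : ℝ) / 2^(n+1) := by
      unfold rd; rw [pow_succ]; push_cast; field_simp
    have er2 : rd (n+1) t = (((2 * ⌊(2:ℝ)^n * t⌋₊ : ℕ) : ℝ) + 1) / 2^(n+1) := by
      unfold rd; rw [e]; push_cast; rfl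
    rw [e, Finset.sum_range_succ, ← er, ← er2]
    abel

theorem cd_bound [NormedAddCommGroup V] {T μ K t : ℝ} {g : ℝ → ℝ → V} (hd : DB T μ K g)
    (ht : t ∈ Set.Icc (0:ℝ) T) {n k : ℕ} (hk : k < ⌊(2:ℝ)^n * t⌋₊) :
    ‖cd g n k‖ ≤ K * (1/2^n) ^ μ := by
  have h0 : (0:ℝ) < 2^n := by positivity
  have hb : ((k:ℝ)+1)/2^n ≤ T := by
    refine le_trans ?_ (rd_mem (n := n) ht).2
    unfold rd
    gcongr
    exact_mod_cast hk
  have ha : (0:ℝ) ≤ (k:ℝ)/2^n := by positivity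
  have e1 : ((k:ℝ)+1)/2^n = (k:ℝ)/2^n + 1/2^n := by ring
  have e2 : (2*(k:ℝ)+1)/2^(n+1) = (k:ℝ)/2^n + 1/2^n/2 := by rw [pow_succ]; field_simp
  have hp : (0:ℝ) < 1/2^n := by positivity
  unfold cd
  rw [e1] at hb ⊢
  rw [e2]
  apply hd _ ⟨by linarith, hb⟩ _ ⟨by linarith, by linarith⟩ _ ⟨ha, by linarith⟩ _ hp
  · rw [abs_le]; constructor <;> linarith
  · rw [abs_le]; constructor <;> linarith

theorem last_bound [NormedAddCommGroup V] {T μ K t : ℝ} {g : ℝ → ℝ → V} (hd : DB T μ K g)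
    (ht : t ∈ Set.Icc (0:ℝ) T) {n : ℕ} :
    ‖delta2 g t (rd (n+1) t) (rd n t)‖ ≤ K * (1/2^n) ^ μ := by
  have hp : (0:ℝ) < 1/2^n := by positivity
  have h1 := rd_mono_level (n := n) (t := t)
  have h2 := rd_le (n := n+1) ht.1
  have h3 := lt_rd (n := n) (t := t)
  apply hd _ ht _ (rd_mem ht) _ (rd_mem ht) _ hp
  · rw [abs_le]; constructor <;> linarith
  · rw [abs_le]; constructor <;> linarith

theorem inc_bound [NormedAddCommGroup V] {T μ K t s : ℝ} {g : ℝ → ℝ → V} (hg : MemC2 T g)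
    (hK : 0 ≤ K) (hd : DB T μ K g)
    (ht : t ∈ Set.Icc (0:ℝ) T) (hs : s ∈ Set.Icc (0:ℝ) T) (hst : s ≤ t) (n : ℕ) :
    ‖(fn g n t - fn g n s) - (fn g (n+1) t - fn g (n+1) s)‖
      ≤ (2^n * (t - s) + 3) * (K * (1/2^n) ^ μ) := by
  have hm : ⌊(2:ℝ)^n * s⌋₊ ≤ ⌊(2:ℝ)^n * t⌋₊ := Nat.floor_mono (by gcongr)
  have e : (fn g n t - fn g n s) - (fn g (n+1) t - fn g (n+1) s) =
      ∑ k ∈ Finset.Ico ⌊(2:ℝ)^n * s⌋₊ ⌊(2:ℝ)^n * t⌋₊, cd g n k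
      + delta2 g t (rd (n+1) t) (rd n t) - delta2 g s (rd (n+1) s) (rd n s) := by
    rw [Finset.sum_Ico_eq_sub _ hm, sub_sub_sub_comm, step hg ht, step hg hs]
    abel
  rw [e]
  have h1 : ‖∑ k ∈ Finset.Ico ⌊(2:ℝ)^n * s⌋₊ ⌊(2:ℝ)^n * t⌋₊, cd g n k‖ ≤
      (2^n * (t - s) + 1) * (K * (1/2^n) ^ μ) := by
    refine (norm_sum_le_of_le _ (fun k hk => cd_bound hd ht (Finset.mem_Ico.1 hk).2)).trans ?_
    rw [Finset.sum_const, nsmul_eq_mul, Nat.card_Ico, Nat.cast_sub hm]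
    gcongr
    have a := Nat.floor_le (a := (2:ℝ)^n * t) (mul_nonneg (by positivity) ht.1)
    have b := Nat.lt_floor_add_one ((2:ℝ)^n * s)
    linarith
  have h2 := last_bound hd ht (n := n)
  have h3 := last_bound hd hs (n := n)
  have h4 := norm_sub_le (∑ k ∈ Finset.Ico ⌊(2:ℝ)^n * s⌋₊ ⌊(2:ℝ)^n * t⌋₊, cd g n k
      + delta2 g t (rd (n+1) t) (rd n t)) (delta2 g s (rd (n+1) s) (rd n s))
  have h5 := norm_add_le (∑ k ∈ Finset.Ico ⌊(2:ℝ)^n * s⌋₊ ⌊(2:ℝ)^n * t⌋₊, cd g n k)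
      (delta2 g t (rd (n+1) t) (rd n t))
  linarith

theorem base_bound [NormedAddCommGroup V] {T μ K t s : ℝ} {g : ℝ → ℝ → V}
    (hK : 0 ≤ K) (hd : DB T μ K g)
    (ht : t ∈ Set.Icc (0:ℝ) T) (hs : s ∈ Set.Icc (0:ℝ) T) (hst : s ≤ t) (n : ℕ)
    (hn : t - s ≤ 1/2^n) :
    ‖(fn g n t - fn g n s) - g t s‖ ≤ 2 * (K * (1/2^n) ^ μ) := by
  have h0 : (0:ℝ) < 2^n := by positivity
  have hp : (0:ℝ) < 1/2^n := by positivity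
  have hKp : 0 ≤ K * (1/2^n : ℝ) ^ μ := by positivity
  have hm : ⌊(2:ℝ)^n * s⌋₊ ≤ ⌊(2:ℝ)^n * t⌋₊ := Nat.floor_mono (by gcongr)
  have hm2 : ⌊(2:ℝ)^n * t⌋₊ ≤ ⌊(2:ℝ)^n * s⌋₊ + 1 := by
    rw [← Nat.floor_add_one (mul_nonneg h0.le hs.1)]
    apply Nat.floor_mono
    rw [le_div_iff₀ h0] at hn
    linarith
  have rt := rd_le (n := n) ht.1
  have rs := rd_le (n := n) hs.1
  have rt' := lt_rd (n := n) (t := t)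
  have rs' := lt_rd (n := n) (t := s)
  rcases (by omega : ⌊(2:ℝ)^n * t⌋₊ = ⌊(2:ℝ)^n * s⌋₊ ∨ ⌊(2:ℝ)^n * t⌋₊ = ⌊(2:ℝ)^n * s⌋₊ + 1)
    with h | h
  · have er : rd n t = rd n s := by unfold rd; rw [h]
    have e : (fn g n t - fn g n s) - g t s = delta2 g t s (rd n s) := by
      unfold fn delta2; rw [er, h]; abel
    rw [e]
    refine (hd t ht s hs _ (rd_mem hs) _ hp ?_ ?_).trans (by linarith)
    · rw [abs_le]; constructor <;> linarith
    · rw [abs_le]; constructor <;> linarith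
  · have er : rd n t = ((⌊(2:ℝ)^n * s⌋₊ : ℝ) + 1)/2^n := by unfold rd; rw [h]; push_cast; rfl
    have er2 : rd n t = rd n s + 1/2^n := by rw [er]; unfold rd; ring
    have e : (fn g n t - fn g n s) - g t s =
        delta2 g (rd n t) s (rd n s) - delta2 g t (rd n t) s := by
      unfold fn delta2; rw [h, Finset.sum_range_succ, ← er]
      change _ + g (rd n t) (rd n s) + _ - _ - _ = _
      abel
    rw [e]
    refine (norm_sub_le _ _).trans ?_
    rw [two_mul]
    refine add_le_add (hd _ (rd_mem ht) s hs _ (rd_mem hs) _ hp ?_ ?_)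
      (hd t ht _ (rd_mem ht) s hs _ hp ?_ ?_) <;>
    · rw [abs_le]; constructor <;> linarith

theorem q_facts {μ : ℝ} (hμ : 1 < μ) : 0 < (2:ℝ)^(1-μ) ∧ (2:ℝ)^(1-μ) < 1 :=
  ⟨by positivity, Real.rpow_lt_one_of_one_lt_of_neg (by norm_num) (by linarith)⟩

theorem pow_eq (μ : ℝ) (n : ℕ) : (2:ℝ)^n * (1/2^n)^μ = ((2:ℝ)^(1-μ))^n := by
  rw [one_div, Real.inv_rpow (by positivity), ← Real.rpow_natCast, ← Real.rpow_natCast,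
    ← Real.rpow_mul (by norm_num), ← Real.rpow_mul (by norm_num), ← Real.rpow_neg (by norm_num),
    ← Real.rpow_add (by norm_num)]
  congr 1; ring

theorem fn_zero [NormedAddCommGroup V] {T : ℝ} (hT : 0 < T) {g : ℝ → ℝ → V} (hg : MemC2 T g)
    (n : ℕ) : fn g n 0 = 0 := by
  unfold fn rd
  simp [hg 0 ⟨le_rfl, hT.le⟩]

theorem exists_lim [NormedAddCommGroup V] [CompleteSpace V] {T μ K : ℝ} (hT : 0 < T)
    (hμ : 1 < μ) {g : ℝ → ℝ → V} (hg : MemC2 T g) (hK : 0 ≤ K) (hd : DB T μ K g) :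
    ∃ f : ℝ → V, ∀ t ∈ Set.Icc (0:ℝ) T,
      Filter.Tendsto (fun n => fn g n t) Filter.atTop (nhds (f t)) := by
  have : ∀ t : ℝ, ∃ l : V, t ∈ Set.Icc (0:ℝ) T →
      Filter.Tendsto (fun n => fn g n t) Filter.atTop (nhds l) := by
    intro t
    by_cases ht : t ∈ Set.Icc (0:ℝ) T
    · have hc : CauchySeq (fun n => fn g n t) := by
        refine cauchySeq_of_le_geometric ((2:ℝ)^(1-μ)) ((T+3)*K) (q_facts hμ).2 fun n => ?_
        have := inc_bound hg hK hd ht ⟨le_rfl, hT.le⟩ ht.1 n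
        rw [fn_zero hT hg, fn_zero hT hg, sub_zero, sub_zero, sub_zero] at this
        rw [dist_eq_norm]
        refine this.trans ?_
        rw [← pow_eq]
        have h1 : (1:ℝ) ≤ 2^n := one_le_pow₀ (by norm_num)
        have h2 : (2:ℝ)^n * t + 3 ≤ 2^n * (T+3) := by nlinarith [ht.2]
        calc _ ≤ (2:ℝ)^n * (T+3) * (K * (1/2^n)^μ) := by gcongr
          _ = _ := by ring
      obtain ⟨l, hl⟩ := cauchySeq_tendsto_of_complete hc
      exact ⟨l, fun _ => hl⟩
    · exact ⟨0, fun h => absurd h ht⟩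
  choose f hf using this
  exact ⟨f, hf⟩

theorem local_bound [NormedAddCommGroup V] {T μ K : ℝ}
    (hμ : 1 < μ) {g : ℝ → ℝ → V} (hg : MemC2 T g) (hK : 0 ≤ K) (hd : DB T μ K g)
    {f : ℝ → V} (hf : ∀ t ∈ Set.Icc (0:ℝ) T,
      Filter.Tendsto (fun n => fn g n t) Filter.atTop (nhds (f t))) :
    ∃ C : ℝ, 0 ≤ C ∧ ∀ t ∈ Set.Icc (0:ℝ) T, ∀ s ∈ Set.Icc (0:ℝ) T, s < t → t - s ≤ 1 →
      ‖f t - f s - g t s‖ ≤ C * (t - s) ^ μ := by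
  obtain ⟨q0, q1⟩ := q_facts hμ
  set q := (2:ℝ)^(1-μ) with hq
  have hq1 : 0 < 1 - q := by linarith
  refine ⟨(4 * K / (1 - q) + 2 * K) * 2 ^ μ, by positivity, ?_⟩
  intro t ht s hs hst h1
  obtain ⟨N, hN1, hN2⟩ := exists_nat_pow_near_of_lt_one (y := (1/2:ℝ)) (sub_pos.2 hst) h1
    (by norm_num) (by norm_num)
  have eN : (1/2:ℝ)^N = 1/2^N := by rw [div_pow, one_pow]
  rw [pow_succ, eN] at hN1
  rw [eN] at hN2
  have hpN : (0:ℝ) < 2^N := by positivity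
  have hb := base_bound hK hd ht hs hst.le N hN2
  have hlim : Filter.Tendsto (fun n => fn g (n+N) t - fn g (n+N) s) Filter.atTop
      (nhds (f t - f s)) :=
    (((hf t ht).sub (hf s hs)).comp (Filter.tendsto_add_atTop_nat N))
  have hgeo : ∀ n, dist (fn g (n+N) t - fn g (n+N) s) (fn g (n+1+N) t - fn g (n+1+N) s) ≤
      (4 * K * (1/2^N)^μ) * q ^ n := by
    intro n
    rw [dist_eq_norm, show n + 1 + N = (n+N)+1 by ring]
    refine (inc_bound hg hK hd ht hs hst.le (n+N)).trans ?_
    have e3 : (2:ℝ)^(n+N) * (1/2^(n+N))^μ = q^n * (2^N * (1/2^N)^μ) := by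
      rw [pow_eq, pow_eq, pow_add]
    have h1 : (1:ℝ) ≤ 2^n := one_le_pow₀ (by norm_num)
    have h2 : (2:ℝ)^(n+N) * (t-s) + 3 ≤ 4 * 2^n := by
      rw [le_div_iff₀ hpN] at hN2
      rw [pow_add]
      nlinarith
    calc _ ≤ (4 * (2:ℝ)^n) * (K * (1/2^(n+N))^μ) := by gcongr
      _ = 4 * K / 2^N * ((2:ℝ)^(n+N) * (1/2^(n+N))^μ) := by rw [pow_add]; field_simp
      _ = _ := by rw [e3]; field_simp
  have hl := dist_le_of_le_geometric_of_tendsto₀ q (4 * K * (1/2^N)^μ) q1 hgeo hlim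
  rw [dist_comm, dist_eq_norm, zero_add] at hl
  have htri : ‖f t - f s - g t s‖ ≤ ‖f t - f s - (fn g N t - fn g N s)‖ +
      ‖(fn g N t - fn g N s) - g t s‖ := norm_sub_le_norm_sub_add_norm_sub _ _ _
  have hx : (1/2^N:ℝ)^μ ≤ 2^μ * (t-s)^μ := by
    rw [← Real.mul_rpow (by norm_num) (sub_pos.2 hst).le]
    apply Real.rpow_le_rpow (by positivity) (by linarith) (by linarith)
  calc _ ≤ 4 * K * (1/2^N)^μ / (1-q) + 2 * (K * (1/2^N)^μ) := by linarith
    _ = (4 * K / (1 - q) + 2 * K) * (1/2^N)^μ := by ring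
    _ ≤ (4 * K / (1 - q) + 2 * K) * (2^μ * (t-s)^μ) := by gcongr
    _ = _ := by ring

theorem local_bound2 [NormedAddCommGroup V] {T μ K C : ℝ}
    (hμ : 1 < μ) {g : ℝ → ℝ → V} (hg : MemC2 T g) (hK : 0 ≤ K) (hd : DB T μ K g)
    {f : ℝ → V} (hC : 0 ≤ C) (h : ∀ t ∈ Set.Icc (0:ℝ) T, ∀ s ∈ Set.Icc (0:ℝ) T, s < t → t - s ≤ 1 →
      ‖f t - f s - g t s‖ ≤ C * (t - s) ^ μ) :
    ∀ t ∈ Set.Icc (0:ℝ) T, ∀ s ∈ Set.Icc (0:ℝ) T, |t - s| ≤ 1 →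
      ‖f t - f s - g t s‖ ≤ (C + K) * |t - s| ^ μ := by
  intro t ht s hs h1
  rcases lt_trichotomy s t with hst | rfl | hst
  · have hp := sub_pos.2 hst
    rw [abs_of_pos hp] at h1 ⊢
    refine (h t ht s hs hst h1).trans ?_
    gcongr; linarith
  · rw [hg s hs]
    simp
    positivity
  · have hp := sub_pos.2 hst
    rw [abs_sub_comm, abs_of_pos hp] at h1 ⊢
    have a := h s hs t ht hst h1
    have b := hd s hs t ht s hs (s - t) hp (by rw [abs_sub_comm, abs_of_pos hp])
      (by rw [abs_of_pos hp])
    have e : f t - f s - g t s = delta2 g s t s - (f s - f t - g s t) := by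
      unfold delta2; rw [hg s hs]; abel
    rw [e]
    refine (norm_sub_le _ _).trans ?_
    linarith

theorem sharp [NormedAddCommGroup V] {T μ K C : ℝ}
    (hμ : 1 < μ) {g : ℝ → ℝ → V} (hd : DB T μ K g)
    {f : ℝ → V} (hg : MemC2 T g) (hK : 0 ≤ K)
    (h : ∀ t ∈ Set.Icc (0:ℝ) T, ∀ s ∈ Set.Icc (0:ℝ) T, |t - s| ≤ 1 →
      ‖f t - f s - g t s‖ ≤ C * |t - s| ^ μ) :
    ∀ t ∈ Set.Icc (0:ℝ) T, ∀ s ∈ Set.Icc (0:ℝ) T,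
      ‖f t - f s - g t s‖ ≤ ((2:ℝ)^μ - 2)⁻¹ * K * |t - s| ^ μ := by
  obtain ⟨q0, q1⟩ := q_facts hμ
  have h2 : (2:ℝ) < 2^μ := by
    simpa using Real.rpow_lt_rpow_of_exponent_lt (x := (2:ℝ)) (by norm_num) hμ
  have hqe : (2:ℝ)^(1-μ) = 2 / 2^μ := by rw [Real.rpow_sub (by norm_num), Real.rpow_one]
  set q := (2:ℝ)^(1-μ) with hq
  set A := ((2:ℝ)^μ - 2)⁻¹ * K with hA
  have hA0 : A * (2^μ - 2) = K := by
    rw [hA]; have : (2:ℝ)^μ - 2 ≠ 0 := by linarith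
    field_simp
  have hA1 : 0 ≤ A := mul_nonneg (inv_nonneg.2 (by linarith)) hK
  have key : ∀ n : ℕ, ∀ t ∈ Set.Icc (0:ℝ) T, ∀ s ∈ Set.Icc (0:ℝ) T, |t - s| ≤ 2^n →
      ‖f t - f s - g t s‖ ≤ (A + q^n * C) * |t - s| ^ μ := by
    intro n
    induction n with
    | zero =>
      intro t ht s hs h1
      refine (h t ht s hs (by simpa using h1)).trans ?_
      rw [pow_zero, one_mul]
      gcongr; linarith
    | succ n ih =>
      intro t ht s hs h1
      rcases eq_or_ne t s with rfl | hne
      · rw [hg t ht, sub_self, sub_self, norm_zero, sub_self, abs_zero,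
          Real.zero_rpow (by linarith), mul_zero]
      have hpos : 0 < |t - s| := abs_pos.2 (sub_ne_zero.2 hne)
      have hm : (t+s)/2 ∈ Set.Icc (0:ℝ) T :=
        ⟨by linarith [ht.1, hs.1], by linarith [ht.2, hs.2]⟩
      have d1 : |t - (t+s)/2| = |t-s|/2 := by
        rw [show t - (t+s)/2 = (t-s)/2 by ring, abs_div, abs_two]
      have d2 : |(t+s)/2 - s| = |t-s|/2 := by
        rw [show (t+s)/2 - s = (t-s)/2 by ring, abs_div, abs_two]
      have hh : |t-s|/2 ≤ 2^n := by rw [pow_succ] at h1; linarith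
      have a := ih t ht _ hm (d1 ▸ hh)
      have b := ih _ hm s hs (d2 ▸ hh)
      have c := hd t ht _ hm s hs (|t-s|/2) (by positivity) d2.le d1.le
      rw [d1] at a
      rw [d2] at b
      have e : f t - f s - g t s = (f t - f ((t+s)/2) - g t ((t+s)/2)) +
          (f ((t+s)/2) - f s - g ((t+s)/2) s) - delta2 g t ((t+s)/2) s := by
        unfold delta2; abel
      rw [e]
      refine ((norm_sub_le _ _).trans (add_le_add_left (norm_add_le _ _) _)).trans ?_
      rw [Real.div_rpow (abs_nonneg _) (by norm_num)] at a b c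
      have hz : (0:ℝ) < 2^μ := by positivity
      calc _ ≤ (A + q^n*C) * (|t-s|^μ/2^μ) + (A + q^n*C) * (|t-s|^μ/2^μ)
              + K * (|t-s|^μ/2^μ) := by linarith
        _ = _ := by
          rw [← hA0, pow_succ, hqe]; field_simp; ring
  intro t ht s hs
  have hlim : Filter.Tendsto (fun n : ℕ => (A + q^n * C) * |t - s| ^ μ) Filter.atTop
      (nhds ((A + 0 * C) * |t-s|^μ)) :=
    (((tendsto_pow_atTop_nhds_zero_of_lt_one q0.le q1).mul_const C).const_add A).mul_const _
  rw [zero_mul, add_zero] at hlim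
  refine ge_of_tendsto hlim ?_
  have := tendsto_pow_atTop_atTop_of_one_lt (r := (2:ℝ)) (by norm_num)
  filter_upwards [this.eventually_ge_atTop |t-s|] with n hn
  exact key n t ht s hs hn

theorem riemann [NormedAddCommGroup V] {T μ A : ℝ} (hμ : 1 < μ) (hA : 0 ≤ A)
    {g : ℝ → ℝ → V} {f : ℝ → V}
    (h : ∀ t ∈ Set.Icc (0:ℝ) T, ∀ s ∈ Set.Icc (0:ℝ) T,
      ‖f t - f s - g t s‖ ≤ A * |t - s| ^ μ)
    (s t : ℝ) (hs : 0 ≤ s) (hst : s < t) (ht : t ≤ T) (ε : ℝ) (hε : 0 < ε) :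
    ∃ δ : ℝ, 0 < δ ∧
        ∀ (n : ℕ) (π : ℕ → ℝ), π 0 = s → π n = t →
          (∀ i < n, π i < π (i + 1)) → (∀ i < n, π (i + 1) - π i < δ) →
          ‖(∑ i ∈ Finset.range n, g (π (i + 1)) (π i)) - (f t - f s)‖ < ε := by
  have hc : Filter.Tendsto (fun x : ℝ => A * x^(μ-1) * (t-s)) (nhds 0) (nhds 0) := by
    have : ContinuousAt (fun x : ℝ => A * x^(μ-1) * (t-s)) 0 :=
      ((Real.continuousAt_rpow_const 0 (μ-1) (Or.inr (by linarith))).const_mul A).mul_const _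
    have h2 := this.tendsto
    simpa [Real.zero_rpow (by linarith : μ - 1 ≠ 0)] using h2
  obtain ⟨r, hr, hr2⟩ := Metric.eventually_nhds_iff.1 (hc.eventually_lt_const hε)
  have hr3 := hr2 (y := r/2) (by rw [Real.dist_eq, sub_zero, abs_of_pos (by positivity)]; linarith)
  refine ⟨r/2, by positivity, ?_⟩
  intro n π h0 hn hlt hmesh
  have mono : ∀ i j, i ≤ j → j ≤ n → π i ≤ π j := by
    intro i j hij
    induction j, hij using Nat.le_induction with
    | base => intro _; exact le_rfl
    | succ j _ ih => intro hj; exact (ih (by omega)).trans (hlt j (by omega)).le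
  have mem : ∀ i ≤ n, π i ∈ Set.Icc (0:ℝ) T := fun i hi =>
    ⟨by have := mono 0 i (by omega) hi; linarith, by have := mono i n hi le_rfl; linarith⟩
  refine lt_of_le_of_lt ?_ hr3
  have e : f t - f s = ∑ i ∈ Finset.range n, (f (π (i+1)) - f (π i)) := by
    rw [Finset.sum_range_sub (fun i => f (π i)), h0, hn]
  have e2 : t - s = ∑ i ∈ Finset.range n, (π (i+1) - π i) := by
    rw [Finset.sum_range_sub (fun i => π i), h0, hn]
  rw [norm_sub_rev, e, e2, ← Finset.sum_sub_distrib, Finset.mul_sum]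
  refine norm_sum_le_of_le _ fun i hi => ?_
  rw [Finset.mem_range] at hi
  have hp := sub_pos.2 (hlt i hi)
  refine (h _ (mem _ hi) _ (mem _ hi.le)).trans ?_
  rw [abs_of_pos hp, mul_assoc]
  gcongr
  rw [show (π (i+1) - π i)^μ = (π (i+1) - π i)^(μ-1) * (π (i+1) - π i) by
    rw [← Real.rpow_add_one hp.ne']; congr 1; ring]
  gcongr
  exact (hmesh i hi).le

end Sew

/-- Integration of small increments: if `g ∈ C₂(V)` with `‖δg‖_μ < ∞`, `μ > 1`, there
is an exact (i.e. `δF = 0`) 1-increment `F` with `‖F − g‖_μ ≤ (2^μ − 2)⁻¹ ‖δg‖_μ`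
which is the limit of the Riemann sums `Σ g_{t_{i+1} t_i}` as the mesh tends to `0`. -/
theorem stmt3 (T : ℝ) (hT : 0 < T) (V : Type u) [NormedAddCommGroup V]
    [NormedSpace ℝ V] [CompleteSpace V] (μ : ℝ) (hμ : 1 < μ)
    (g : ℝ → ℝ → V) (hg : MemC2 T g)
    (hdec : ∃ n hs ρ K, DecompBound T μ (delta2 g) n hs ρ K) :
    ∃ F : ℝ → ℝ → V,
      MemC2 T F ∧
      (∀ t ∈ Set.Icc (0 : ℝ) T, ∀ u ∈ Set.Icc (0 : ℝ) T, ∀ s ∈ Set.Icc (0 : ℝ) T,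
        delta2 F t u s = 0) ∧
      (∀ (n : ℕ) (hs : Fin n → ℝ → ℝ → ℝ → V) (ρ K : Fin n → ℝ),
        DecompBound T μ (delta2 g) n hs ρ K →
        ∀ t ∈ Set.Icc (0 : ℝ) T, ∀ s ∈ Set.Icc (0 : ℝ) T,
          ‖F t s - g t s‖ ≤ ((2 : ℝ) ^ μ - 2)⁻¹ * (∑ i, K i) * |t - s| ^ μ) ∧
      (∀ s t : ℝ, 0 ≤ s → s < t → t ≤ T → ∀ ε : ℝ, 0 < ε → ∃ δ : ℝ, 0 < δ ∧
        ∀ (n : ℕ) (π : ℕ → ℝ), π 0 = s → π n = t →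
          (∀ i < n, π i < π (i + 1)) → (∀ i < n, π (i + 1) - π i < δ) →
          ‖(∑ i ∈ Finset.range n, g (π (i + 1)) (π i)) - F t s‖ < ε) := by
  obtain ⟨n0, hs0, ρ0, K0, h0⟩ := hdec
  have hd := Sew.db_of_decomp h0
  have hK : 0 ≤ ∑ i, K0 i := Finset.sum_nonneg fun i _ => h0.2.1 i
  obtain ⟨f, hf⟩ := Sew.exists_lim hT hμ hg hK hd
  obtain ⟨C, hC, hloc⟩ := Sew.local_bound hμ hg hK hd hf
  have hloc2 := Sew.local_bound2 hμ hg hK hd hC hloc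
  have h2 : (2:ℝ) < 2^μ := by
    simpa using Real.rpow_lt_rpow_of_exponent_lt (x := (2:ℝ)) (by norm_num) hμ
  refine ⟨fun t s => f t - f s, fun t _ => sub_self _, ?_, ?_, ?_⟩
  · intro t _ u _ s _
    change f t - f s - (f t - f u) - (f u - f s) = 0
    abel
  · intro n hs ρ K h
    exact Sew.sharp hμ (Sew.db_of_decomp h) hg (Finset.sum_nonneg fun i _ => h.2.1 i) hloc2
  · exact Sew.riemann hμ (mul_nonneg (inv_nonneg.2 (by linarith)) hK)
      (Sew.sharp hμ hd hg hK hloc2)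
end

section
/- Let n ≥ 2 and let f^1,…,f^n : [0,T] → ℝ be continuously differentiable. Then for all s, u, t ∈ [0,T]: J_{ts}(df^n⋯df^1) − J_{tu}(df^n⋯df^1) − J_{us}(df^n⋯df^1) = Σ_{i=1}^{n−1} J_{tu}(df^n⋯df^{i+1}) · J_{us}(df^i⋯df^1). In particular δ(J(df^2 df^1))_{tus} = (f^2_t − f^2_u)(f^1_u − f^1_s); moreover, for continuously differentiable g, f : [0,T] → ℝ, the 1-increment J_{ts}(dg f) := ∫_s^t g′(v) f(v) dv satisfies δ(J(dg f)) = 0. -/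
open scoped BigOperators

/-- The iterated integral `J_{ts}(df^n ⋯ df^1)` of a list `[f^n, …, f^1]` of smooth
functions (head = outermost differential): `J_{ts}(df) = f_t − f_s` and
`J_{ts}(df^m ⋯ df^1) = ∫_s^t (f^m)'(v) J_{vs}(df^{m−1} ⋯ df^1) dv`. -/
noncomputable def iterJ : List (ℝ → ℝ) → ℝ → ℝ → ℝ
  | [], _, _ => 1
  | [f], t, s => f t - f s
  | f :: g :: fs, t, s => ∫ v in s..t, deriv f v * iterJ (g :: fs) v s

theorem iterJ_cons (f : ℝ → ℝ) (hf : ContDiff ℝ 1 f) (l : List (ℝ → ℝ)) (t s : ℝ) :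
    iterJ (f :: l) t s = ∫ v in s..t, deriv f v * iterJ l v s := by
  cases l with
  | nil =>
    simp only [iterJ, mul_one]
    rw [intervalIntegral.integral_deriv_eq_sub]
    · intro x _
      exact hf.differentiable one_ne_zero x
    · exact (hf.continuous_deriv le_rfl).intervalIntegrable _ _
  | cons g fs => simp only [iterJ]

theorem iterJ_continuous (L : List (ℝ → ℝ)) (hL : ∀ f ∈ L, ContDiff ℝ 1 f) (s : ℝ) :
    Continuous (fun t => iterJ L t s) := by
  induction L with
  | nil => simp only [iterJ]; exact continuous_const
  | cons f l ih =>
    have hf := hL f (by simp)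
    have hl := ih (fun g hg => hL g (by simp [hg]))
    simp only [iterJ_cons f hf]
    exact intervalIntegral.continuous_primitive
      (fun a b => ((hf.continuous_deriv le_rfl).mul hl).intervalIntegrable a b) s

theorem iterJ_chen (L : List (ℝ → ℝ)) (hL : ∀ f ∈ L, ContDiff ℝ 1 f) (s u t : ℝ) :
    iterJ L t s = ∑ k ∈ Finset.range (L.length + 1),
      iterJ (L.take k) t u * iterJ (L.drop k) u s := by
  induction L generalizing t with
  | nil => simp [iterJ]
  | cons f l ih =>
    have hf := hL f (by simp)
    have hl' : ∀ g ∈ l, ContDiff ℝ 1 g := fun g hg => hL g (by simp [hg])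
    have hd := hf.continuous_deriv le_rfl
    have hi : ∀ a b, IntervalIntegrable (fun v => deriv f v * iterJ l v s)
        MeasureTheory.volume a b :=
      fun a b => (hd.mul (iterJ_continuous l hl' s)).intervalIntegrable a b
    rw [List.length_cons, Finset.sum_range_succ']
    simp only [List.take_succ_cons, List.drop_succ_cons, List.take_zero, List.drop_zero]
    rw [iterJ_cons f hf l t s, ← intervalIntegral.integral_add_adjacent_intervals (hi s u) (hi u t),
      ← iterJ_cons f hf l u s, add_comm]
    congr 1
    · simp only [ih hl', Finset.mul_sum]
      rw [intervalIntegral.integral_finset_sum]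
      · refine Finset.sum_congr rfl fun k _ => ?_
        rw [iterJ_cons f hf, ← intervalIntegral.integral_mul_const]
        simp only [mul_assoc]
      · intro k _
        have hc := iterJ_continuous (l.take k) (fun g hg => hl' g (List.mem_of_mem_take hg)) u
        exact (hd.mul (hc.mul continuous_const)).intervalIntegrable _ _
    · simp [iterJ]

theorem iterJ_delta (L : List (ℝ → ℝ)) (hn : 2 ≤ L.length)
    (hL : ∀ f ∈ L, ContDiff ℝ 1 f) (s u t : ℝ) :
    iterJ L t s - iterJ L t u - iterJ L u s =
        ∑ k ∈ Finset.Ico 1 L.length, iterJ (L.take k) t u * iterJ (L.drop k) u s := by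
  rw [iterJ_chen L hL s u t, Finset.sum_range_succ, Finset.range_eq_Ico,
    Finset.sum_eq_sum_Ico_succ_bot (by omega)]
  simp [iterJ]

/-- `δ` of iterated integrals: for `C¹` functions `f^1, …, f^n` (`n ≥ 2`),
`(δ J(df^n⋯df^1))_{tus} = Σ_{i=1}^{n−1} J_{tu}(df^n⋯df^{i+1}) J_{us}(df^i⋯df^1)`;
in particular `(δ J(df² df¹))_{tus} = (f²_t − f²_u)(f¹_u − f¹_s)`, and the
1-increment `J_{ts}(dg f) = ∫_s^t g' f` satisfies `δ(J(dg f)) = 0`. -/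
theorem stmt4 (T : ℝ) (hT : 0 < T) (L : List (ℝ → ℝ)) (hn : 2 ≤ L.length)
    (hL : ∀ f ∈ L, ContDiff ℝ 1 f) :
    (∀ s ∈ Set.Icc (0 : ℝ) T, ∀ u ∈ Set.Icc (0 : ℝ) T, ∀ t ∈ Set.Icc (0 : ℝ) T,
      iterJ L t s - iterJ L t u - iterJ L u s =
        ∑ k ∈ Finset.Ico 1 L.length, iterJ (L.take k) t u * iterJ (L.drop k) u s) ∧
    (∀ g f : ℝ → ℝ, ContDiff ℝ 1 g → ContDiff ℝ 1 f →
      ∀ s ∈ Set.Icc (0 : ℝ) T, ∀ u ∈ Set.Icc (0 : ℝ) T, ∀ t ∈ Set.Icc (0 : ℝ) T,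
        (iterJ [g, f] t s - iterJ [g, f] t u - iterJ [g, f] u s =
          (g t - g u) * (f u - f s)) ∧
        ((∫ v in s..t, deriv g v * f v) - (∫ v in u..t, deriv g v * f v) -
            (∫ v in s..u, deriv g v * f v) = 0)) := by
  refine ⟨fun s _ u _ t _ => iterJ_delta L hn hL s u t, ?_⟩
  intro g f hg hf s _ u _ t _
  refine ⟨?_, ?_⟩
  · rw [iterJ_delta [g, f] (by simp) (by simp [hg, hf]) s u t]
    simp [iterJ]
  · have hi : ∀ a b, IntervalIntegrable (fun v => deriv g v * f v) MeasureTheory.volume a b :=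
      fun a b => ((hg.continuous_deriv le_rfl).mul hf.continuous).intervalIntegrable a b
    rw [← intervalIntegral.integral_add_adjacent_intervals (hi s u) (hi u t)]
    ring
end

section
/- (Acyclicity of the convolutional complex.) For every n ≥ 1 and every F ∈ Ĉ_n(B) one has δ̂(δ̂F) = 0; and for every n ≥ 1 and every A ∈ Ĉ_{n+1}(B) with δ̂A = 0 there exists C ∈ Ĉ_n(B) with δ̂C = A (one admissible choice being C(t_1,…,t_n) := (−1)^{n+1} A(t_1,…,t_n,0)). Thus (Ĉ_*(B), δ̂) is an acyclic cochain complex. -/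
open scoped BigOperators

universe u

variable {B : Type u} [NormedAddCommGroup B] [NormedSpace ℝ B]

/-- A strongly continuous semigroup of bounded operators on `B`,
uniformly bounded in operator norm by `M`. -/
def IsSG (S : ℝ → B →L[ℝ] B) (M : ℝ) : Prop :=
  S 0 = ContinuousLinearMap.id ℝ B ∧
  (∀ s t : ℝ, 0 ≤ s → 0 ≤ t → S (t + s) = (S t).comp (S s)) ∧
  (∀ x : B, ContinuousOn (fun t => S t x) (Set.Ici 0)) ∧
  ∀ t : ℝ, 0 ≤ t → ‖S t‖ ≤ M

/-- The `n`-simplex `𝒮_n = {T ≥ t₁ ≥ ⋯ ≥ t_n ≥ 0}`. -/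
def simplexSet (T : ℝ) (n : ℕ) : Set (Fin n → ℝ) :=
  {t | (∀ i, t i ∈ Set.Icc (0 : ℝ) T) ∧ ∀ i j : Fin n, i ≤ j → t j ≤ t i}

/-- The perturbed coboundary `δ̂A = δA − a A`, where `a_{ts} = S_{t−s} − Id`:
`(δ̂A)(t₁,…,t_{n+1}) = Σᵢ (−1)^i A(t₁,…,t̂ᵢ,…,t_{n+1}) − (S_{t₁t₂} − Id) A(t₂,…,t_{n+1})`. -/
noncomputable def hatDelta (S : ℝ → B →L[ℝ] B) (n : ℕ)
    (A : (Fin n → ℝ) → B) : (Fin (n + 1) → ℝ) → B :=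
  fun t =>
    (∑ i : Fin (n + 1), ((-1 : ℝ) ^ ((i : ℕ) + 1)) • A (t ∘ i.succAbove)) -
      (S (t 0 - t 1) (A (t ∘ Fin.succ)) - A (t ∘ Fin.succ))

theorem hatDelta_eq (S : ℝ → B →L[ℝ] B) (hS0 : S 0 = ContinuousLinearMap.id ℝ B) (m : ℕ)
    (A : (Fin (m + 1) → ℝ) → B) (t : Fin (m + 2) → ℝ) :
    hatDelta S (m + 1) A t = ∑ i : Fin (m + 2), ((-1 : ℝ) ^ ((i : ℕ) + 1)) •
      S (t 0 - t (i.succAbove 0)) (A (t ∘ i.succAbove)) := by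
  unfold hatDelta
  rw [Fin.sum_univ_succ, Fin.sum_univ_succ (n := m + 1)]
  have h : ∀ i : Fin (m + 1), S (t 0 - t (i.succ.succAbove 0)) (A (t ∘ i.succ.succAbove))
      = A (t ∘ i.succ.succAbove) := by
    intro i
    rw [Fin.succ_succAbove_zero, sub_self, hS0]
    rfl
  simp only [h]
  have h2 : (Fin.succAbove (0 : Fin (m + 2))) = Fin.succ := by
    funext j; simp
  rw [h2]
  simp
  abel

theorem stmt5_sq (T : ℝ) (S : ℝ → B →L[ℝ] B) (M : ℝ) (hS : IsSG S M) (m : ℕ)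
    (F : (Fin (m + 1) → ℝ) → B) (t : Fin (m + 3) → ℝ) (ht : t ∈ simplexSet T (m + 3)) :
    hatDelta S (m + 2) (hatDelta S (m + 1) F) t = 0 := by
  obtain ⟨h0, hadd, -, -⟩ := hS
  rw [hatDelta_eq S h0]
  have key : ∀ (i : Fin (m + 3)),
      ((-1 : ℝ) ^ ((i : ℕ) + 1)) • S (t 0 - t (i.succAbove 0))
        (hatDelta S (m + 1) F (t ∘ i.succAbove)) =
      ∑ j : Fin (m + 2), ((-1 : ℝ) ^ ((i : ℕ) + (j : ℕ))) •
        S (t 0 - t (i.succAbove (j.succAbove 0))) (F (t ∘ (i.succAbove ∘ j.succAbove))) := by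
    intro i
    rw [hatDelta_eq S h0, map_sum, Finset.smul_sum]
    refine Finset.sum_congr rfl fun j _ => ?_
    have e : S (t 0 - t (i.succAbove (j.succAbove 0)))
        = (S (t 0 - t (i.succAbove 0))).comp
          (S (t (i.succAbove 0) - t (i.succAbove (j.succAbove 0)))) := by
      rw [← hadd]
      · congr 1; ring
      · exact sub_nonneg.2 (ht.2 _ _ ((Fin.strictMono_succAbove i).monotone (Fin.zero_le _)))
      · exact sub_nonneg.2 (ht.2 _ _ (Fin.zero_le _))
    rw [e, map_smul, smul_smul]
    congr 1
    ring
  rw [Finset.sum_congr rfl fun i _ => key i, ← Finset.sum_product']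
  refine Finset.sum_involution (fun p _ => (p.1.succAbove p.2, p.2.predAbove p.1)) ?_ ?_ ?_ ?_
  · rintro ⟨i, j⟩ -
    have hc : (i.succAbove j).succAbove ∘ (j.predAbove i).succAbove
        = i.succAbove ∘ j.succAbove := by
      funext k
      exact Fin.succAbove_succAbove_succAbove_predAbove i j k
    have hc0 := congrFun hc 0
    simp only [Function.comp] at hc0
    simp only [hc, hc0]
    rw [← add_smul, Fin.neg_one_pow_succAbove_add_predAbove]
    simp
  · rintro ⟨i, j⟩ - - h
    exact Fin.succAbove_ne i j (congrArg Prod.fst h)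
  · simp
  · rintro ⟨i, j⟩ -
    simp [Fin.succAbove_succAbove_predAbove, Fin.predAbove_predAbove_succAbove]

theorem snoc_mem_simplexSet {T : ℝ} (hT : 0 < T) {n : ℕ} {t : Fin n → ℝ}
    (ht : t ∈ simplexSet T n) :
    (Fin.snoc t 0 : Fin (n + 1) → ℝ) ∈ simplexSet T (n + 1) := by
  constructor
  · intro i
    refine Fin.lastCases ?_ (fun i => ?_) i
    · simp [hT.le]
    · simpa using ht.1 i
  · intro i j
    refine Fin.lastCases ?_ (fun j => ?_) j
    · intro _
      refine Fin.lastCases ?_ (fun i => ?_) i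
      · simp
      · simpa using (ht.1 i).1
    · refine Fin.lastCases ?_ (fun i => ?_) i
      · intro h
        exact absurd h (not_le.2 (Fin.castSucc_lt_last j))
      · intro h
        simpa using ht.2 i j (by simpa using h)

theorem stmt5_exact (T : ℝ) (hT : 0 < T) (S : ℝ → B →L[ℝ] B)
    (hS0 : S 0 = ContinuousLinearMap.id ℝ B) (m : ℕ)
    (A : (Fin (m + 2) → ℝ) → B)
    (hA : ∀ t ∈ simplexSet T (m + 3), hatDelta S (m + 2) A t = 0)
    (t : Fin (m + 2) → ℝ) (ht : t ∈ simplexSet T (m + 2)) :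
    hatDelta S (m + 1) (fun t => ((-1 : ℝ) ^ (m + 1 + 1)) • A (Fin.snoc t 0)) t = A t := by
  have h := hA _ (snoc_mem_simplexSet hT ht)
  rw [hatDelta_eq S hS0, Fin.sum_univ_castSucc] at h
  have e1 : ∀ i : Fin (m + 2), (Fin.snoc t 0 : Fin (m + 3) → ℝ) ∘ i.castSucc.succAbove
      = (Fin.snoc (t ∘ i.succAbove) 0 : Fin (m + 2) → ℝ) := by
    intro i
    funext k
    refine Fin.lastCases ?_ (fun k => ?_) k
    · simp
    · simp [Fin.castSucc_succAbove_castSucc]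
  have e2 : (Fin.snoc t 0 : Fin (m + 3) → ℝ) ∘ (Fin.last (m + 2)).succAbove = t := by
    funext k
    simp
  have e3 : ∀ i : Fin (m + 2), (Fin.snoc t 0 : Fin (m + 3) → ℝ) (i.castSucc.succAbove 0)
      = t (i.succAbove 0) := by
    intro i
    have := congrFun (e1 i) (Fin.castSucc 0)
    simpa using this
  have e4 : (Fin.snoc t 0 : Fin (m + 3) → ℝ) 0 = t 0 := by
    have : (0 : Fin (m + 3)) = Fin.castSucc 0 := rfl
    rw [this, Fin.snoc_castSucc]
  have e5 : (Fin.snoc t 0 : Fin (m + 3) → ℝ) ((Fin.last (m + 2)).succAbove 0) = t 0 := by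
    exact congrFun e2 0
  simp only [e1, e2, e3, e4, e5, sub_self, hS0, Fin.val_castSucc, Fin.val_last,
    ContinuousLinearMap.id_apply] at h
  rw [hatDelta_eq S hS0]
  simp only [map_smul]
  simp only [smul_comm _ ((-1 : ℝ) ^ (m + 1 + 1))]
  rw [← Finset.smul_sum, eq_neg_of_add_eq_zero_left h, smul_neg, smul_smul, ← neg_smul]
  have : -((-1 : ℝ) ^ (m + 1 + 1) * (-1) ^ (m + 2 + 1)) = 1 := by
    rw [← pow_add, show m + 1 + 1 + (m + 2 + 1) = 2 * (m + 2) + 1 by ring, pow_succ, pow_mul]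
    simp
  rw [this, one_smul]

/-- The convolutional complex `(Ĉ_*(B), δ̂)` is an acyclic cochain complex:
`δ̂ δ̂ = 0` on the simplex, and every `δ̂`-closed increment `A ∈ Ĉ_{n+1}(B)` is
`δ̂C` for some `C ∈ Ĉ_n(B)`, an admissible choice being
`C(t₁,…,t_n) = (−1)^{n+1} A(t₁,…,t_n,0)`. -/
theorem stmt5 (T : ℝ) (hT : 0 < T) (S : ℝ → B →L[ℝ] B) (M : ℝ) (hM : 1 ≤ M)
    (hS : IsSG S M) (n : ℕ) (hn : 1 ≤ n) :
    (∀ F : (Fin n → ℝ) → B, ContinuousOn F (simplexSet T n) →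
      ∀ t ∈ simplexSet T (n + 2), hatDelta S (n + 1) (hatDelta S n F) t = 0) ∧
    (∀ A : (Fin (n + 1) → ℝ) → B, ContinuousOn A (simplexSet T (n + 1)) →
      (∀ t ∈ simplexSet T (n + 2), hatDelta S (n + 1) A t = 0) →
      ∃ C : (Fin n → ℝ) → B, ContinuousOn C (simplexSet T n) ∧
        (∀ t ∈ simplexSet T (n + 1), hatDelta S n C t = A t) ∧
        C = fun t => ((-1 : ℝ) ^ (n + 1)) • A (Fin.snoc t 0)) := by
  obtain ⟨m, rfl⟩ : ∃ m, n = m + 1 := ⟨n - 1, by omega⟩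
  refine ⟨fun F _ t ht => stmt5_sq T S M hS m F t ht, fun A hAc hA => ⟨_, ?_, ?_, rfl⟩⟩
  · refine ContinuousOn.const_smul ?_ _
    refine hAc.comp (Continuous.continuousOn ?_) fun t ht => snoc_mem_simplexSet hT ht
    refine continuous_pi fun i => ?_
    refine Fin.lastCases ?_ (fun i => ?_) i
    · simpa using continuous_const
    · simpa using continuous_apply i
  · exact stmt5_exact T hT S hS.1 m A hA
end

section
/- Let μ > 1. If h ∈ Ĉ_2(B) satisfies δ̂h = 0 (i.e. h_{ts} = h_{tu} + S_{tu} h_{us} for all (t,u,s) ∈ 𝒮_3) and ‖h‖_μ < ∞, then h = 0. -/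
universe u

variable {B : Type u} [NormedAddCommGroup B] [NormedSpace ℝ B]

/-- If `h ∈ Ĉ₂(B)` satisfies `δ̂h = 0` (i.e. `h_{ts} = h_{tu} + S_{tu} h_{us}`) and
`‖h‖_μ < ∞` for some `μ > 1`, then `h = 0` on the simplex `𝒮₂`. -/
theorem stmt6 (T : ℝ) (hT : 0 < T) (S : ℝ → B →L[ℝ] B) (M : ℝ) (hM : 1 ≤ M)
    (hS : IsSG S M) (μ : ℝ) (hμ : 1 < μ) (h : ℝ → ℝ → B)
    (hcont : ContinuousOn (fun q : ℝ × ℝ => h q.1 q.2)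
      {q : ℝ × ℝ | 0 ≤ q.2 ∧ q.2 ≤ q.1 ∧ q.1 ≤ T})
    (hker : ∀ t u s : ℝ, 0 ≤ s → s ≤ u → u ≤ t → t ≤ T →
      h t s = h t u + S (t - u) (h u s))
    (hnorm : ∃ K : ℝ, 0 ≤ K ∧ ∀ t s : ℝ, 0 ≤ s → s ≤ t → t ≤ T →
      ‖h t s‖ ≤ K * (t - s) ^ μ) :
    ∀ t s : ℝ, 0 ≤ s → s ≤ t → t ≤ T → h t s = 0 := by
  obtain ⟨hS0, hSadd, -, hSM⟩ := hS
  obtain ⟨K, hK, hb⟩ := hnorm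
  intro t s hs hst ht
  have hM0 : 0 ≤ M := by linarith
  have key : ∀ d : ℝ, 0 ≤ d → ∀ k : ℕ, s + k * d ≤ t →
      ‖S (t - (s + k * d)) (h (s + k * d) s)‖ ≤ k * (M * (K * d ^ μ)) := by
    intro d hd k
    induction k with
    | zero =>
      intro _
      have h0 : h s s = 0 := by
        have := hb s s hs le_rfl (hst.trans ht)
        rw [sub_self, Real.zero_rpow (by linarith), mul_zero] at this
        exact norm_le_zero_iff.mp this
      simp [h0]
    | succ k ih =>
      intro hk
      push_cast at hk ⊢
      have hkd : 0 ≤ (k : ℝ) * d := by positivity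
      have h1 : s + k * d ≤ t := by linarith
      have h2 := ih h1
      have e := hker (s + (k + 1) * d) (s + k * d) s hs (by linarith) (by linarith) (by linarith)
      have e2 := hSadd (s + (k + 1) * d - (s + k * d)) (t - (s + (k + 1) * d))
        (by linarith) (by linarith)
      rw [show t - (s + (k + 1) * d) + (s + (k + 1) * d - (s + k * d)) = t - (s + k * d) by
        ring] at e2
      rw [e2] at h2
      rw [e, map_add]
      have h3 := hb (s + (k + 1) * d) (s + k * d) (by linarith) (by linarith) (by linarith)
      rw [show s + (k + 1) * d - (s + k * d) = d by ring] at h3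
      have h4 : ‖S (t - (s + (k + 1) * d)) (h (s + (k + 1) * d) (s + k * d))‖
          ≤ M * (K * d ^ μ) :=
        (ContinuousLinearMap.le_opNorm _ _).trans
          (mul_le_mul (hSM _ (by linarith)) h3 (norm_nonneg _) hM0)
      refine (norm_add_le _ _).trans ?_
      rw [ContinuousLinearMap.comp_apply] at h2
      linarith
  have bound : ∀ n : ℕ, 0 < n → ‖h t s‖ ≤ M * K * (t - s) ^ μ * (n : ℝ) ^ (-(μ - 1)) := by
    intro n hn
    have hn' : (0 : ℝ) < n := by exact_mod_cast hn
    have e : s + n * ((t - s) / n) = t := by field_simp; ring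
    have h1 := key ((t - s) / n) (div_nonneg (by linarith) hn'.le) n e.le
    rw [e, sub_self, hS0, ContinuousLinearMap.id_apply,
      Real.div_rpow (by linarith) hn'.le] at h1
    refine h1.trans (le_of_eq ?_)
    rw [neg_sub, Real.rpow_sub hn', Real.rpow_one]
    ring
  have lim : Filter.Tendsto (fun n : ℕ => M * K * (t - s) ^ μ * (n : ℝ) ^ (-(μ - 1)))
      Filter.atTop (nhds 0) := by
    have := ((tendsto_rpow_neg_atTop (show 0 < μ - 1 by linarith)).comp
      tendsto_natCast_atTop_atTop).const_mul (M * K * (t - s) ^ μ)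
    simpa using this
  have := ge_of_tendsto lim (Filter.eventually_atTop.mpr ⟨1, fun n hn => bound n hn⟩)
  exact norm_le_zero_iff.mp this
end

section
/- (Integration of weakly controlled paths, step-3 case.) Let κ_0 > κ > 0 with κ_0 + 3κ > 1. Assume X^1, X^2, X^3 : 𝒮_2 → L(B) are continuous, vanish on the diagonal, satisfy ‖X^i_{ts}‖_{op} ≤ K (t−s)^{iκ_0} (i = 1,2,3) and the Chen relations, valid for all (t,u,s) ∈ 𝒮_3: X^1_{ts} = X^1_{tu} S_{us} + S_{tu} X^1_{us}; X^2_{ts} = X^2_{tu} S_{us} + S_{tu} X^2_{us} + X^1_{tu} X^1_{us}; X^3_{ts} = X^3_{tu} S_{us} + S_{tu} X^3_{us} + X^1_{tu} X^2_{us} + X^2_{tu} X^1_{us}. Let y, y^1, y^2 : [0,T] → B be continuous and bounded, such that ‖δ̂y^2‖_κ < ∞, the remainder y^{1,r}_{ts} := (δ̂y^1)_{ts} − X^1_{ts} y^2_s satisfies ‖y^{1,r}‖_{2κ} < ∞, and the remainder y^r_{ts} := (δ̂y)_{ts} − X^1_{ts} y^1_s − X^2_{ts} y^2_s satisfies ‖y^r‖_{3κ}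 < ∞. Then there exists a unique continuous J : 𝒮_2 → B such that δ̂J = 0 (i.e. J_{ts} = J_{tu} + S_{tu} J_{us}) and sup_{t>s} ‖J_{ts} − X^1_{ts} y_s − X^2_{ts} y^1_s − X^3_{ts} y^2_s‖/(t−s)^{κ_0+3κ} < ∞; moreover, for every (t,s) ∈ 𝒮_2 with s < t, J_{ts} is the limit, as the mesh tends to zero, of Σ_{i=0}^{n−1} S_{t − t_{i+1}} [ X^1_{t_{i+1} t_i} y_{t_i} + X^2_{t_{i+1} t_i} y^1_{t_i} + X^3_{t_{i+1} t_i} y^2_{t_i} ] over partitions s = t_0 < t_1 < ⋯ < t_n = t of [s,t]. -/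
open scoped BigOperators

universe u

variable {B : Type u} [NormedAddCommGroup B] [NormedSpace ℝ B]

lemma aux_small (c a ε : ℝ) (ha : 0 < a) (hε : 0 < ε) : ∃ δ : ℝ, 0 < δ ∧ c * δ ^ a < ε := by
  have h1 : Filter.Tendsto (fun δ : ℝ => c * δ ^ a) (nhdsWithin 0 (Set.Ioi 0)) (nhds 0) := by
    have h2 : ContinuousAt (fun δ : ℝ => c * δ ^ a) 0 :=
      continuousAt_const.mul (Real.continuousAt_rpow_const 0 a (Or.inr ha.le))
    have h3 := h2.tendsto
    simp only [Real.zero_rpow ha.ne', mul_zero] at h3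
    exact h3.mono_left nhdsWithin_le_nhds
  have h4 := (h1.eventually (gt_mem_nhds hε)).and self_mem_nhdsWithin
  obtain ⟨δ, h5, h6⟩ := h4.exists
  exact ⟨δ, h6, h5⟩

lemma sg_joint {S : ℝ → B →L[ℝ] B} {M : ℝ} (hM : 1 ≤ M) (hS : IsSG S M) :
    ContinuousOn (fun p : ℝ × B => S p.1 p.2) {p | 0 ≤ p.1} := by
  obtain ⟨_, _, hc, hb⟩ := hS
  rintro ⟨r, x⟩ hr
  simp only [Set.mem_setOf_eq] at hr
  rw [ContinuousWithinAt, tendsto_iff_norm_sub_tendsto_zero]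
  have h1 : Filter.Tendsto (fun p : ℝ × B => M * ‖p.2 - x‖ + ‖S p.1 x - S r x‖)
      (nhdsWithin (r, x) {p | 0 ≤ p.1}) (nhds (M * ‖x - x‖ + ‖S r x - S r x‖)) := by
    refine Filter.Tendsto.add ?_ ?_
    · have : Continuous (fun p : ℝ × B => M * ‖p.2 - x‖) := by fun_prop
      exact this.continuousWithinAt
    · have h2 : ContinuousWithinAt (fun p : ℝ × B => S p.1 x) {p | 0 ≤ p.1} (r, x) :=
        ContinuousWithinAt.comp (t := Set.Ici 0) (f := fun p : ℝ × B => p.1)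
          (g := fun t => S t x) (hc x r hr) continuous_fst.continuousWithinAt (fun p hp => hp)
      exact (h2.sub continuousWithinAt_const).norm
  simp only [sub_self, norm_zero, mul_zero, add_zero] at h1
  refine squeeze_zero' (Filter.Eventually.of_forall fun _ => norm_nonneg _) ?_ h1
  filter_upwards [self_mem_nhdsWithin] with p hp
  have : S p.1 p.2 - S r x = S p.1 (p.2 - x) + (S p.1 x - S r x) := by
    rw [map_sub]; abel
  rw [this]
  refine (norm_add_le _ _).trans (add_le_add ?_ le_rfl)
  exact ((S p.1).le_opNorm _).trans (mul_le_mul_of_nonneg_right (hb _ hp) (norm_nonneg _))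

/-- the simplex -/
def Simp (T : ℝ) : Set (ℝ × ℝ) := {q : ℝ × ℝ | 0 ≤ q.2 ∧ q.2 ≤ q.1 ∧ q.1 ≤ T}

/-- sums over the finite set `F`, described by their properties -/
def IsSum (T : ℝ) (S : ℝ → B →L[ℝ] B) (Ξ : ℝ → ℝ → B) (F : Finset ℝ) (A : ℝ → ℝ → B) : Prop :=
  ContinuousOn (fun q : ℝ × ℝ => A q.1 q.2) (Simp T) ∧
  (∀ t s, 0 ≤ s → s ≤ t → t ≤ T → (∀ u ∈ F, ¬ (s < u ∧ u < t)) → A t s = Ξ t s) ∧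
  (∀ t u s, 0 ≤ s → s ≤ u → u ≤ t → t ≤ T → (u ∈ F ∨ u = s ∨ u = t) →
    A t s = A t u + S (t - u) (A u s))

lemma sg_mul {S : ℝ → B →L[ℝ] B} {M : ℝ} (hS : IsSG S M) {a b : ℝ} (ha : 0 ≤ a) (hb : 0 ≤ b)
    (x : B) : S a (S b x) = S (a + b) x := by
  rw [hS.2.1 b a hb ha]; rfl

lemma exists_sum {T M : ℝ} {S : ℝ → B →L[ℝ] B} (hM : 1 ≤ M) (hS : IsSG S M) {Ξ : ℝ → ℝ → B}
    (hc : ContinuousOn (fun q : ℝ × ℝ => Ξ q.1 q.2) (Simp T))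
    (hd : ∀ t, 0 ≤ t → t ≤ T → Ξ t t = 0) (F : Finset ℝ) :
    ∃ A, IsSum T S Ξ F A := by
  have S0 : ∀ x, S 0 x = x := fun x => by rw [hS.1]; rfl
  induction F using Finset.induction_on with
  | empty =>
    refine ⟨Ξ, hc, fun _ _ _ _ _ _ => rfl, ?_⟩
    rintro t u s h0 h1 h2 h3 (h | rfl | rfl)
    · simp at h
    · rw [hd u h0 (h2.trans h3), map_zero, add_zero]
    · rw [hd u (h0.trans h1) h3, sub_self, S0, zero_add]
  | insert v F hv ih =>
    obtain ⟨A, hAc, hAe, hAa⟩ := ih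
    have hA0 : ∀ t, 0 ≤ t → t ≤ T → A t t = 0 := by
      intro t h0 h1
      rw [hAe t t h0 le_rfl h1 (fun u _ h => lt_irrefl _ (h.1.trans h.2)), hd t h0 h1]
    set A' : ℝ → ℝ → B := fun t s =>
      A t (max s (min v t)) + S (t - max s (min v t)) (A (max s (min v t)) s) with hA'
    have e1 : ∀ t s, 0 ≤ s → s ≤ t → t ≤ T → v ≤ s → A' t s = A t s := by
      intro t s h0 h1 h2 h3
      simp only [hA']
      rw [min_eq_left (h3.trans h1), max_eq_left h3, hA0 s h0 (h1.trans h2), map_zero, add_zero]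
    have e2 : ∀ t s, 0 ≤ s → s ≤ t → t ≤ T → t ≤ v → A' t s = A t s := by
      intro t s h0 h1 h2 h3
      simp only [hA']
      rw [min_eq_right h3, max_eq_right h1, hA0 t (h0.trans h1) h2, sub_self, S0, zero_add]
    have e3 : ∀ t s, s ≤ v → v ≤ t → A' t s = A t v + S (t - v) (A v s) := by
      intro t s h0 h1
      simp only [hA']
      rw [min_eq_left h1, max_eq_right h0]
    refine ⟨A', ?_, ?_, ?_⟩
    · have cm : Continuous (fun q : ℝ × ℝ => max q.2 (min v q.1)) := by fun_prop
      refine ContinuousOn.add ?_ ?_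
      · refine ContinuousOn.comp (t := Simp T)
          (f := fun q : ℝ × ℝ => (q.1, max q.2 (min v q.1))) hAc ?_ ?_
        · exact (continuous_fst.prodMk cm).continuousOn
        · rintro ⟨t, s⟩ ⟨h0, h1, h2⟩
          exact ⟨le_max_of_le_left h0, max_le h1 (min_le_right _ _), h2⟩
      · refine ContinuousOn.comp (t := {p : ℝ × B | 0 ≤ p.1})
          (f := fun q : ℝ × ℝ => (q.1 - max q.2 (min v q.1), A (max q.2 (min v q.1)) q.2))
          (sg_joint hM hS) ?_ ?_
        · refine ContinuousOn.prodMk (continuous_fst.sub cm).continuousOn ?_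
          refine ContinuousOn.comp (t := Simp T)
            (f := fun q : ℝ × ℝ => (max q.2 (min v q.1), q.2)) hAc ?_ ?_
          · exact (cm.prodMk continuous_snd).continuousOn
          · rintro ⟨t, s⟩ ⟨h0, h1, h2⟩
            exact ⟨h0, le_max_left _ _, (max_le h1 (min_le_right _ _)).trans h2⟩
        · rintro ⟨t, s⟩ ⟨h0, h1, h2⟩
          exact sub_nonneg.2 (max_le h1 (min_le_right _ _))
    · intro t s h0 h1 h2 h
      have hF := hAe t s h0 h1 h2 (fun u hu => h u (Finset.mem_insert_of_mem hu))
      rw [← hF]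
      by_cases h3 : v ≤ s
      · exact e1 t s h0 h1 h2 h3
      · exact e2 t s h0 h1 h2 (not_lt.1 fun h4 => h v (Finset.mem_insert_self _ _)
          ⟨not_le.1 h3, h4⟩)
    · intro t u s h0 h1 h2 h3 hu
      have h0u := h0.trans h1
      by_cases huv : u = v
      · subst huv
        rw [e3 t s h1 h2, e1 t u h0u h2 h3 le_rfl, e2 u s h0 h1 (h2.trans h3) le_rfl]
      have hu' : u ∈ F ∨ u = s ∨ u = t := by
        rcases hu with hu | hu
        · exact Or.inl ((Finset.mem_insert.1 hu).resolve_left huv)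
        · exact Or.inr hu
      rcases le_total v s with hvs | hvs
      · rw [e1 t s h0 (h1.trans h2) h3 hvs, e1 t u h0u h2 h3 (hvs.trans h1),
          e1 u s h0 h1 (h2.trans h3) hvs]
        exact hAa t u s h0 h1 h2 h3 hu'
      rcases le_total t v with htv | htv
      · rw [e2 t s h0 (h1.trans h2) h3 htv, e2 t u h0u h2 h3 htv,
          e2 u s h0 h1 (h2.trans h3) (h2.trans htv)]
        exact hAa t u s h0 h1 h2 h3 hu'
      have h0v := h0.trans hvs
      rcases le_total v u with hvu | hvu
      · rw [e3 t s hvs htv, e1 t u h0u h2 h3 hvu, e3 u s hvs hvu]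
        have hu2 : u ∈ F ∨ u = v ∨ u = t := by
          rcases hu' with h | h | h
          · exact Or.inl h
          · exact absurd (le_antisymm (h ▸ hvs) hvu) huv
          · exact Or.inr (Or.inr h)
        rw [hAa t u v h0v hvu h2 h3 hu2, map_add, sg_mul hS (sub_nonneg.2 h2) (sub_nonneg.2 hvu),
          sub_add_sub_cancel]
        abel
      · rw [e3 t s hvs htv, e3 t u hvu htv, e2 u s h0 h1 (h2.trans h3) hvu]
        have hu2 : u ∈ F ∨ u = s ∨ u = v := by
          rcases hu' with h | h | h
          · exact Or.inl h
          · exact Or.inr (Or.inl h)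
          · exact absurd (le_antisymm hvu (h ▸ htv)) huv
        rw [hAa v u s h0 h1 hvu (htv.trans h3) hu2, map_add,
          sg_mul hS (sub_nonneg.2 htv) (sub_nonneg.2 hvu), sub_add_sub_cancel]
        abel

lemma exists_gap (F : Finset ℝ) {s m t : ℝ} (h1 : s ≤ m) (h2 : m ≤ t) :
    ∃ a b, s ≤ a ∧ a ≤ m ∧ m ≤ b ∧ b ≤ t ∧ (a ∈ F ∨ a = s) ∧ (b ∈ F ∨ b = t) ∧
      ∀ u ∈ F, ¬ (a < u ∧ u < b) := by
  classical
  have n1 : (insert s (F.filter (fun u => s ≤ u ∧ u ≤ m))).Nonempty := ⟨s, by simp⟩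
  have n2 : (insert t (F.filter (fun u => m ≤ u ∧ u ≤ t))).Nonempty := ⟨t, by simp⟩
  obtain ⟨a, ha, ha'⟩ := Finset.exists_max_image _ id n1
  obtain ⟨b, hb, hb'⟩ := Finset.exists_min_image _ id n2
  simp only [Finset.mem_insert, Finset.mem_filter, id] at ha ha' hb hb'
  refine ⟨a, b, ?_, ?_, ?_, ?_, by tauto, by tauto, ?_⟩
  · rcases ha with h | h <;> grind
  · rcases ha with h | h <;> grind
  · rcases hb with h | h <;> grind
  · rcases hb with h | h <;> grind
  · rintro u hu ⟨h3, h4⟩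
    rcases le_total u m with h | h
    · have := ha' u
      have := ha' s
      grind
    · have := hb' u
      have := hb' t
      grind

/-- maximal inequality -/
lemma sum_bound {T M : ℝ} {S : ℝ → B →L[ℝ] B} (hM : 1 ≤ M) (hS : IsSG S M) {Ξ : ℝ → ℝ → B}
    (hd : ∀ t, 0 ≤ t → t ≤ T → Ξ t t = 0) {C C' μ : ℝ} (hC : 0 ≤ C) (hC' : 0 ≤ C')
    (hμ : 1 < μ) (hCC : C' * (2 * (1 / 2 : ℝ) ^ μ) + 2 * M * C = C')
    (hδ : ∀ t u s, 0 ≤ s → s ≤ u → u ≤ t → t ≤ T →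
      ‖Ξ t s - Ξ t u - S (t - u) (Ξ u s)‖ ≤ C * (t - s) ^ μ)
    {F : Finset ℝ} {A : ℝ → ℝ → B} (hA : IsSum T S Ξ F A) :
    ∀ n : ℕ, ∀ t s, 0 ≤ s → s ≤ t → t ≤ T → (F.filter (fun u => s < u ∧ u < t)).card = n →
      ∀ r, 0 ≤ r → ‖S r (A t s - Ξ t s)‖ ≤ C' * (t - s) ^ μ := by
  obtain ⟨hAc, hAe, hAa⟩ := hA
  have hop : ∀ r x, 0 ≤ r → ‖S r x‖ ≤ M * ‖x‖ := fun r x hr =>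
    ((S r).le_opNorm _).trans (mul_le_mul_of_nonneg_right (hS.2.2.2 _ hr) (norm_nonneg _))
  have hA0 : ∀ t, 0 ≤ t → t ≤ T → A t t - Ξ t t = 0 := by
    intro t h0 h1
    rw [hAe t t h0 le_rfl h1 (fun u _ h => lt_irrefl _ (h.1.trans h.2)), sub_self]
  intro n
  induction n using Nat.strong_induction_on with
  | _ n ih =>
    intro t s h0 hst hT hn r hr
    obtain ⟨a, b, hsa, ham, hmb, hbt, haF, hbF, hab⟩ :=
      exists_gap F (s := s) (m := (s + t) / 2) (t := t) (by linarith) (by linarith)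
    have h0a := h0.trans hsa
    have hab' := ham.trans hmb
    have h0b := h0a.trans hab'
    have hbT := hbt.trans hT
    have haT := hab'.trans hbT
    have half : ∀ x, 0 ≤ x → x ≤ (t - s) / 2 →
        C' * x ^ μ ≤ C' * ((1 / 2 : ℝ) ^ μ * (t - s) ^ μ) := by
      intro x hx hx'
      rw [← Real.mul_rpow (by norm_num) (by linarith)]
      refine mul_le_mul_of_nonneg_left (Real.rpow_le_rpow hx (by linarith) (by linarith)) hC'
    have b1 : ∀ r, 0 ≤ r → ‖S r (A a s - Ξ a s)‖ ≤ C' * ((1 / 2 : ℝ) ^ μ * (t - s) ^ μ) := by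
      intro r hr
      rcases eq_or_lt_of_le hsa with h | h
      · rw [← h, hA0 s h0 (hst.trans hT), map_zero, norm_zero]
        have := Real.rpow_nonneg (sub_nonneg.2 hst) μ
        positivity
      · rcases eq_or_lt_of_le (hab'.trans hbt) with h' | h'
        · have : t = s := by linarith
          linarith
        refine (ih _ ?_ a s h0 hsa haT rfl r hr).trans (half _ (by linarith) (by linarith))
        rw [← hn]
        refine Finset.card_lt_card (Finset.ssubset_iff_subset_ne.2 ⟨?_, ?_⟩)
        · intro u hu
          rw [Finset.mem_filter] at hu ⊢
          exact ⟨hu.1, hu.2.1, hu.2.2.trans h'⟩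
        · intro he
          have : a ∈ F.filter (fun u => s < u ∧ u < t) :=
            Finset.mem_filter.2 ⟨haF.resolve_right h.ne', h, h'⟩
          rw [← he, Finset.mem_filter] at this
          exact lt_irrefl _ this.2.2
    have b2 : ∀ r, 0 ≤ r → ‖S r (A t b - Ξ t b)‖ ≤ C' * ((1 / 2 : ℝ) ^ μ * (t - s) ^ μ) := by
      intro r hr
      rcases eq_or_lt_of_le hbt with h | h
      · rw [← h, hA0 b h0b hbT, map_zero, norm_zero]
        have := Real.rpow_nonneg (sub_nonneg.2 (h ▸ hst)) μ
        positivity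
      · rcases eq_or_lt_of_le (hsa.trans hab') with h' | h'
        · have : t = s := by linarith
          linarith
        refine (ih _ ?_ t b h0b hbt hT rfl r hr).trans (half _ (by linarith) (by linarith))
        rw [← hn]
        refine Finset.card_lt_card (Finset.ssubset_iff_subset_ne.2 ⟨?_, ?_⟩)
        · intro u hu
          rw [Finset.mem_filter] at hu ⊢
          exact ⟨hu.1, h'.trans hu.2.1, hu.2.2⟩
        · intro he
          have : b ∈ F.filter (fun u => s < u ∧ u < t) :=
            Finset.mem_filter.2 ⟨hbF.resolve_right h.ne, h', h⟩
          rw [← he, Finset.mem_filter] at this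
          exact lt_irrefl _ this.2.1
    have R1 := hδ t b s h0 (hsa.trans hab') hbt hT
    have R2 := (hδ b a s h0 hsa hab' hbT).trans (mul_le_mul_of_nonneg_left
      (Real.rpow_le_rpow (by linarith) (by linarith : b - s ≤ t - s) (by linarith)) hC)
    have E1 := hAa t b s h0 (hsa.trans hab') hbt hT (by tauto)
    have E2 := hAa b a s h0 hsa hab' hbT (by tauto)
    have E3 := hAe b a h0a hab' hbT hab
    have key : S r (A t s - Ξ t s) = S r (A t b - Ξ t b)
        + S (r + (t - b) + (b - a)) (A a s - Ξ a s)
        - S r (Ξ t s - Ξ t b - S (t - b) (Ξ b s))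
        - S (r + (t - b)) (Ξ b s - Ξ b a - S (b - a) (Ξ a s)) := by
      rw [← sg_mul hS (by linarith) (by linarith), ← sg_mul hS hr (by linarith : 0 ≤ t - b),
        ← sg_mul hS hr (by linarith : 0 ≤ t - b), E1, E2, E3]
      simp only [map_sub, map_add]
      abel
    rw [key]
    have n1 := (norm_sub_le (S r (A t b - Ξ t b)
        + S (r + (t - b) + (b - a)) (A a s - Ξ a s)
        - S r (Ξ t s - Ξ t b - S (t - b) (Ξ b s)))
        (S (r + (t - b)) (Ξ b s - Ξ b a - S (b - a) (Ξ a s))))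
    have n2 := norm_sub_le (S r (A t b - Ξ t b)
        + S (r + (t - b) + (b - a)) (A a s - Ξ a s))
        (S r (Ξ t s - Ξ t b - S (t - b) (Ξ b s)))
    have n3 := norm_add_le (S r (A t b - Ξ t b)) (S (r + (t - b) + (b - a)) (A a s - Ξ a s))
    have m1 := b2 r hr
    have m2 := b1 (r + (t - b) + (b - a)) (by linarith)
    have m3 := (hop r _ hr).trans (mul_le_mul_of_nonneg_left R1 (by linarith))
    have m4 := (hop (r + (t - b)) _ (by linarith)).trans
      (mul_le_mul_of_nonneg_left R2 (by linarith))
    have fin : C' * (t - s) ^ μ = 2 * (C' * ((1 / 2 : ℝ) ^ μ * (t - s) ^ μ))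
        + 2 * (M * (C * (t - s) ^ μ)) := by
      conv_lhs => rw [← hCC]
      ring
    linarith

lemma rpow_split {x d μ : ℝ} (hx : 0 ≤ x) (hxd : x ≤ d) (hμ : 1 < μ) :
    x ^ μ ≤ d ^ (μ - 1) * x := by
  have : x ^ μ = x ^ (μ - 1) * x := by
    conv_lhs => rw [show μ = (μ - 1) + 1 by ring]
    rw [Real.rpow_add_of_nonneg hx (by linarith) (by norm_num), Real.rpow_one]
  rw [this]
  exact mul_le_mul_of_nonneg_right (Real.rpow_le_rpow hx hxd (by linarith)) hx

lemma refine_bound {T : ℝ} {S : ℝ → B →L[ℝ] B} {M : ℝ} (hS : IsSG S M) {Ξ : ℝ → ℝ → B}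
    {C' μ d : ℝ} (hC' : 0 ≤ C') (hμ : 1 < μ)
    {F G : Finset ℝ} (hFG : F ⊆ G) {A A' : ℝ → ℝ → B} (hA : IsSum T S Ξ F A)
    (hA' : IsSum T S Ξ G A')
    (hF : ∀ t s, 0 ≤ s → s ≤ t → t ≤ T → (∀ u ∈ F, ¬ (s < u ∧ u < t)) → t - s ≤ d)
    (hb : ∀ t s, 0 ≤ s → s ≤ t → t ≤ T → ∀ r, 0 ≤ r →
      ‖S r (A' t s - Ξ t s)‖ ≤ C' * (t - s) ^ μ) :
    ∀ n : ℕ, ∀ t s, 0 ≤ s → s ≤ t → t ≤ T → (F.filter (fun u => s < u ∧ u < t)).card = n →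
      ∀ r, 0 ≤ r → ‖S r (A' t s - A t s)‖ ≤ C' * d ^ (μ - 1) * (t - s) := by
  intro n
  induction n using Nat.strong_induction_on with
  | _ n ih =>
    intro t s h0 hst hT hn r hr
    by_cases h : ∀ u ∈ F, ¬ (s < u ∧ u < t)
    · rw [hA.2.1 t s h0 hst hT h]
      refine (hb t s h0 hst hT r hr).trans ?_
      rw [mul_assoc]
      exact mul_le_mul_of_nonneg_left
        (rpow_split (by linarith) (hF t s h0 hst hT h) hμ) hC'
    · push Not at h
      obtain ⟨u, huF, hsu, hut⟩ := h
      have i1 := ih (F.filter (fun v => s < v ∧ v < u)).card (by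
        rw [← hn]
        refine Finset.card_lt_card (Finset.ssubset_iff_subset_ne.2 ⟨?_, ?_⟩)
        · intro v hv
          rw [Finset.mem_filter] at hv ⊢
          exact ⟨hv.1, hv.2.1, hv.2.2.trans hut⟩
        · intro he
          have : u ∈ F.filter (fun u => s < u ∧ u < t) :=
            Finset.mem_filter.2 ⟨huF, hsu, hut⟩
          rw [← he, Finset.mem_filter] at this
          exact lt_irrefl _ this.2.2) u s h0 hsu.le (hut.le.trans hT) rfl
          (r + (t - u)) (by linarith)
      have i2 := ih (F.filter (fun v => u < v ∧ v < t)).card (by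
        rw [← hn]
        refine Finset.card_lt_card (Finset.ssubset_iff_subset_ne.2 ⟨?_, ?_⟩)
        · intro v hv
          rw [Finset.mem_filter] at hv ⊢
          exact ⟨hv.1, hsu.trans hv.2.1, hv.2.2⟩
        · intro he
          have : u ∈ F.filter (fun u => s < u ∧ u < t) :=
            Finset.mem_filter.2 ⟨huF, hsu, hut⟩
          rw [← he, Finset.mem_filter] at this
          exact lt_irrefl _ this.2.1) t u (h0.trans hsu.le) hut.le hT rfl r hr
      have E1 := hA.2.2 t u s h0 hsu.le hut.le hT (Or.inl huF)
      have E2 := hA'.2.2 t u s h0 hsu.le hut.le hT (Or.inl (hFG huF))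
      have key : S r (A' t s - A t s) = S r (A' t u - A t u)
          + S (r + (t - u)) (A' u s - A u s) := by
        rw [← sg_mul hS hr (by linarith), E1, E2]
        simp only [map_sub, map_add]
        abel
      rw [key]
      refine (norm_add_le _ _).trans ((add_le_add i2 i1).trans (le_of_eq ?_))
      ring

lemma exists_fine (T d : ℝ) (hd : 0 < d) : ∃ F : Finset ℝ,
    ∀ t s, 0 ≤ s → s ≤ t → t ≤ T → (∀ u ∈ F, ¬ (s < u ∧ u < t)) → t - s ≤ d := by
  refine ⟨(Finset.range (⌊T / d⌋₊ + 2)).image (fun k : ℕ => (k : ℝ) * d), ?_⟩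
  intro t s h0 hst hT h
  by_contra hlt
  push Not at hlt
  have hk1 : (⌊s / d⌋₊ : ℝ) ≤ s / d := Nat.floor_le (by positivity)
  have hk2 : s / d < (⌊s / d⌋₊ : ℝ) + 1 := Nat.lt_floor_add_one _
  rw [le_div_iff₀ hd] at hk1
  rw [div_lt_iff₀ hd] at hk2
  refine h (((⌊s / d⌋₊ + 1 : ℕ) : ℝ) * d) (Finset.mem_image.2 ⟨_, ?_, rfl⟩) ⟨?_, ?_⟩
  · rw [Finset.mem_range]
    have : ⌊s / d⌋₊ ≤ ⌊T / d⌋₊ := Nat.floor_mono (by gcongr; linarith)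
    omega
  · push_cast; linarith
  · push_cast; linarith

lemma sewing [CompleteSpace B] {T M : ℝ} (hT : 0 < T) {S : ℝ → B →L[ℝ] B} (hM : 1 ≤ M)
    (hS : IsSG S M) {Ξ : ℝ → ℝ → B}
    (hc : ContinuousOn (fun q : ℝ × ℝ => Ξ q.1 q.2) (Simp T))
    (hd : ∀ t, 0 ≤ t → t ≤ T → Ξ t t = 0) {C μ : ℝ} (hC : 0 ≤ C) (hμ : 1 < μ)
    (hδ : ∀ t u s, 0 ≤ s → s ≤ u → u ≤ t → t ≤ T →
      ‖Ξ t s - Ξ t u - S (t - u) (Ξ u s)‖ ≤ C * (t - s) ^ μ) :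
    ∃ J : ℝ → ℝ → B, ContinuousOn (fun q : ℝ × ℝ => J q.1 q.2) (Simp T) ∧
      (∀ t u s : ℝ, 0 ≤ s → s ≤ u → u ≤ t → t ≤ T → J t s = J t u + S (t - u) (J u s)) ∧
      (∃ K' : ℝ, 0 ≤ K' ∧ ∀ t s : ℝ, 0 ≤ s → s ≤ t → t ≤ T →
          ‖J t s - Ξ t s‖ ≤ K' * (t - s) ^ μ) := by
  classical
  have S0 : ∀ x, S 0 x = x := fun x => by rw [hS.1]; rfl
  choose A hA using exists_sum hM hS hc hd
  have hp : 0 < 1 - 2 * (1 / 2 : ℝ) ^ μ := by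
    have := Real.rpow_lt_rpow_of_exponent_gt (x := (1 / 2 : ℝ)) (by norm_num) (by norm_num) hμ
    rw [Real.rpow_one] at this
    linarith
  obtain ⟨C', hC', hCC⟩ : ∃ C' : ℝ, 0 ≤ C' ∧ C' * (2 * (1 / 2 : ℝ) ^ μ) + 2 * M * C = C' := by
    refine ⟨2 * M * C / (1 - 2 * (1 / 2 : ℝ) ^ μ), by positivity, ?_⟩
    generalize (1 / 2 : ℝ) ^ μ = z at hp
    field_simp
    ring
  have hb : ∀ F t s, 0 ≤ s → s ≤ t → t ≤ T → ∀ r, 0 ≤ r →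
      ‖S r (A F t s - Ξ t s)‖ ≤ C' * (t - s) ^ μ := fun F t s h0 h1 h2 =>
    sum_bound hM hS hd hC hC' hμ hCC hδ (hA F) _ t s h0 h1 h2 rfl
  -- uniform Cauchy
  have hcau : ∀ ε > 0, ∃ F : Finset ℝ, ∀ G, F ⊆ G → ∀ t s, 0 ≤ s → s ≤ t → t ≤ T →
      ‖A G t s - A F t s‖ ≤ ε := by
    intro ε hε
    obtain ⟨d, hd0, hd1⟩ := aux_small (C' * T) (μ - 1) ε (by linarith) hε
    obtain ⟨F, hF⟩ := exists_fine T d hd0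
    refine ⟨F, fun G hFG t s h0 h1 h2 => ?_⟩
    have := refine_bound hS hC' hμ hFG (hA F) (hA G) hF (hb G) _ t s h0 h1 h2 rfl 0 le_rfl
    rw [S0] at this
    refine this.trans (le_trans ?_ hd1.le)
    have h3 := Real.rpow_nonneg hd0.le (μ - 1)
    calc C' * d ^ (μ - 1) * (t - s) ≤ C' * d ^ (μ - 1) * T :=
          mul_le_mul_of_nonneg_left (by linarith) (by positivity)
      _ = _ := by ring
  have hlim : ∀ t s, ∃ L, 0 ≤ s → s ≤ t → t ≤ T →
      Filter.Tendsto (fun F => A F t s) Filter.atTop (nhds L) := by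
    intro t s
    by_cases h : 0 ≤ s ∧ s ≤ t ∧ t ≤ T
    · have : CauchySeq (fun F => A F t s) := by
        rw [Metric.cauchySeq_iff']
        intro ε hε
        obtain ⟨F, hF⟩ := hcau (ε / 2) (by linarith)
        refine ⟨F, fun G hG => ?_⟩
        rw [dist_eq_norm]
        exact (hF G hG t s h.1 h.2.1 h.2.2).trans_lt (by linarith)
      obtain ⟨L, hL⟩ := cauchySeq_tendsto_of_complete this
      exact ⟨L, fun _ _ _ => hL⟩
    · exact ⟨0, fun h0 h1 h2 => absurd ⟨h0, h1, h2⟩ h⟩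
  choose J hJ using hlim
  refine ⟨J, ?_, ?_, C', hC', ?_⟩
  · have hu : TendstoUniformlyOn (fun F (q : ℝ × ℝ) => A F q.1 q.2) (fun q => J q.1 q.2)
        Filter.atTop (Simp T) := by
      rw [Metric.tendstoUniformlyOn_iff]
      intro ε hε
      obtain ⟨F, hF⟩ := hcau (ε / 3) (by linarith)
      filter_upwards [Filter.eventually_ge_atTop F] with G hG q hq
      have h1 : ‖J q.1 q.2 - A F q.1 q.2‖ ≤ ε / 3 := by
        refine le_of_tendsto ((hJ q.1 q.2 hq.1 hq.2.1 hq.2.2).sub_const _).norm ?_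
        filter_upwards [Filter.eventually_ge_atTop F] with H hH
        exact hF H hH _ _ hq.1 hq.2.1 hq.2.2
      have h2 := hF G hG q.1 q.2 hq.1 hq.2.1 hq.2.2
      rw [← dist_eq_norm] at h1 h2
      have := dist_triangle_right (J q.1 q.2) (A G q.1 q.2) (A F q.1 q.2)
      linarith
    exact hu.continuousOn (Filter.Frequently.of_forall fun F => (hA F).1)
  · intro t u s h0 h1 h2 h3
    have l1 := hJ t s h0 (h1.trans h2) h3
    have l2 := hJ t u (h0.trans h1) h2 h3
    have l3 := ((S (t - u)).continuous.tendsto _).comp (hJ u s h0 h1 (h2.trans h3))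
    refine tendsto_nhds_unique_of_eventuallyEq l1 (l2.add l3) ?_
    filter_upwards [Filter.eventually_ge_atTop {u}] with F hF
    exact (hA F).2.2 t u s h0 h1 h2 h3 (Or.inl (hF (Finset.mem_singleton_self u)))
  · intro t s h0 h1 h2
    refine le_of_tendsto ((hJ t s h0 h1 h2).sub_const _).norm (Filter.Eventually.of_forall ?_)
    intro F
    have := hb F t s h0 h1 h2 0 le_rfl
    rwa [S0] at this

lemma riemann_bound {T M : ℝ} {S : ℝ → B →L[ℝ] B} (hM : 1 ≤ M)
    (hS : IsSG S M) {Ξ J : ℝ → ℝ → B} {K' μ d : ℝ} (hK : 0 ≤ K') (hμ : 1 < μ)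
    (hJ : ∀ t u s : ℝ, 0 ≤ s → s ≤ u → u ≤ t → t ≤ T → J t s = J t u + S (t - u) (J u s))
    (hb : ∀ t s : ℝ, 0 ≤ s → s ≤ t → t ≤ T → ‖J t s - Ξ t s‖ ≤ K' * (t - s) ^ μ) 
    (π : ℕ → ℝ) (h0 : 0 ≤ π 0) (n : ℕ) (hn : π n ≤ T)
    (h1 : ∀ i < n, π i < π (i + 1)) (h2 : ∀ i < n, π (i + 1) - π i < d) :
    ‖(∑ i ∈ Finset.range n, S (π n - π (i + 1)) (Ξ (π (i + 1)) (π i))) - J (π n) (π 0)‖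
      ≤ M * K' * d ^ (μ - 1) * (π n - π 0) := by
  have S0 : ∀ x, S 0 x = x := fun x => by rw [hS.1]; rfl
  have mono : ∀ j ≤ n, ∀ i ≤ j, π i ≤ π j := by
    intro j
    induction j with
    | zero => intro _ i hi; rw [Nat.le_zero.1 hi]
    | succ j ih =>
      intro hj i hi
      rcases Nat.lt_or_ge i (j + 1) with h | h
      · exact (ih (by omega) i (by omega)).trans (h1 j (by omega)).le
      · rw [le_antisymm hi h]
  have hJ0 : J (π 0) (π 0) = 0 := by
    have := hJ (π 0) (π 0) (π 0) h0 le_rfl le_rfl ((mono n le_rfl 0 (by omega)).trans hn)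
    rw [sub_self, S0] at this
    simpa using this
  have tel : ∀ j ≤ n, S (π n - π j) (J (π j) (π 0)) =
      ∑ i ∈ Finset.range j, S (π n - π (i + 1)) (J (π (i + 1)) (π i)) := by
    intro j
    induction j with
    | zero => intro _; simp [hJ0]
    | succ j ih =>
      intro hj
      have a1 := mono n le_rfl (j + 1) hj
      have a2 := h1 j (by omega)
      rw [Finset.sum_range_succ, ← ih (by omega),
        hJ (π (j + 1)) (π j) (π 0) h0 (mono j (by omega) 0 (by omega)) a2.le (a1.trans hn),
        map_add, sg_mul hS (by linarith) (by linarith), sub_add_sub_cancel]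
      abel
  have e := tel n le_rfl
  rw [sub_self, S0] at e
  rw [e, ← Finset.sum_sub_distrib, ← Finset.sum_range_sub, Finset.mul_sum]
  refine (norm_sum_le _ _).trans (Finset.sum_le_sum ?_)
  intro i hi
  rw [Finset.mem_range] at hi
  have a0 := h0.trans (mono i hi.le 0 (by omega))
  have a1 := mono n le_rfl (i + 1) hi
  have a2 := h1 i hi
  rw [← map_sub]
  calc _ ≤ M * ‖Ξ (π (i + 1)) (π i) - J (π (i + 1)) (π i)‖ :=
        ((S _).le_opNorm _).trans (mul_le_mul_of_nonneg_right
          (hS.2.2.2 _ (by linarith)) (norm_nonneg _))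
    _ ≤ M * (K' * (d ^ (μ - 1) * (π (i + 1) - π i))) := by
        rw [norm_sub_rev]
        refine mul_le_mul_of_nonneg_left ((hb _ _ a0 a2.le (a1.trans hn)).trans ?_) (by linarith)
        exact mul_le_mul_of_nonneg_left (rpow_split (by linarith) (h2 i hi).le hμ) hK
    _ = _ := by ring

lemma riemann_lim {T M : ℝ} {S : ℝ → B →L[ℝ] B} (hM : 1 ≤ M)
    (hS : IsSG S M) {Ξ J : ℝ → ℝ → B} {K' μ : ℝ} (hK : 0 ≤ K') (hμ : 1 < μ)
    (hJ : ∀ t u s : ℝ, 0 ≤ s → s ≤ u → u ≤ t → t ≤ T → J t s = J t u + S (t - u) (J u s))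
    (hb : ∀ t s : ℝ, 0 ≤ s → s ≤ t → t ≤ T → ‖J t s - Ξ t s‖ ≤ K' * (t - s) ^ μ) :
    ∀ t s : ℝ, 0 ≤ s → s < t → t ≤ T → ∀ ε : ℝ, 0 < ε → ∃ δ : ℝ, 0 < δ ∧
        ∀ (n : ℕ) (π : ℕ → ℝ), π 0 = s → π n = t →
          (∀ i < n, π i < π (i + 1)) → (∀ i < n, π (i + 1) - π i < δ) →
          ‖(∑ i ∈ Finset.range n, S (t - π (i + 1)) (Ξ (π (i + 1)) (π i))) - J t s‖ < ε := by
  intro t s h0 h1 h2 ε hε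
  obtain ⟨d, hd, hd'⟩ := aux_small (M * K' * (t - s)) (μ - 1) ε (by linarith) hε
  refine ⟨d, hd, ?_⟩
  rintro n π rfl rfl h3 h4
  refine (riemann_bound hM hS hK hμ hJ hb π h0 n h2 h3 h4).trans_lt ?_
  linarith

lemma sew_unique_s13 {T M : ℝ} {S : ℝ → B →L[ℝ] B} (hM : 1 ≤ M)
    (hS : IsSG S M) {Ξ J J' : ℝ → ℝ → B} {K' K μ : ℝ} (hK : 0 ≤ K) (hK' : 0 ≤ K') (hμ : 1 < μ)
    (hJ : ∀ t u s : ℝ, 0 ≤ s → s ≤ u → u ≤ t → t ≤ T → J t s = J t u + S (t - u) (J u s))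
    (hb : ∀ t s : ℝ, 0 ≤ s → s ≤ t → t ≤ T → ‖J t s - Ξ t s‖ ≤ K * (t - s) ^ μ)
    (hJ' : ∀ t u s : ℝ, 0 ≤ s → s ≤ u → u ≤ t → t ≤ T → J' t s = J' t u + S (t - u) (J' u s))
    (hb' : ∀ t s : ℝ, 0 ≤ s → s ≤ t → t ≤ T → ‖J' t s - Ξ t s‖ ≤ K' * (t - s) ^ μ) :
    ∀ t s : ℝ, 0 ≤ s → s ≤ t → t ≤ T → J' t s = J t s := by
  intro t s h0 h1 h2
  rcases eq_or_lt_of_le h1 with rfl | h1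
  · have a := hb s s h0 le_rfl h2
    have b := hb' s s h0 le_rfl h2
    rw [sub_self, Real.zero_rpow (by linarith), mul_zero] at a b
    rw [sub_eq_zero.1 (norm_le_zero_iff.1 a), sub_eq_zero.1 (norm_le_zero_iff.1 b)]
  rw [← sub_eq_zero, ← norm_le_zero_iff]
  refine le_of_forall_pos_le_add fun ε hε => ?_
  obtain ⟨d, hd, H⟩ := riemann_lim hM hS hK hμ hJ hb t s h0 h1 h2 (ε / 2) (by linarith)
  obtain ⟨d', hd', H'⟩ := riemann_lim hM hS hK' hμ hJ' hb' t s h0 h1 h2 (ε / 2) (by linarith)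
  obtain ⟨n, hn⟩ := exists_nat_gt ((t - s) / min d d')
  have hm : 0 < min d d' := lt_min hd hd'
  have hn0 : (0 : ℝ) < n := lt_of_le_of_lt (div_nonneg (by linarith) hm.le) hn
  have hst : 0 < t - s := by linarith
  have hstep : (t - s) / n < min d d' := by
    rw [div_lt_iff₀ hm] at hn
    rw [div_lt_iff₀ hn0]; linarith
  have hpos : 0 < (t - s) / n := by positivity
  let π : ℕ → ℝ := fun i => s + i * ((t - s) / n)
  have p0 : π 0 = s := by simp [π]
  have pn : π n = t := by simp only [π]; field_simp; ring
  have ps : ∀ i, π (i + 1) - π i = (t - s) / n := by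
    intro i; simp only [π]; push_cast; ring
  have a := H n π p0 pn (fun i _ => by linarith [ps i])
    (fun i _ => by rw [ps i]; exact hstep.trans_le (min_le_left _ _))
  have b := H' n π p0 pn (fun i _ => by linarith [ps i])
    (fun i _ => by rw [ps i]; exact hstep.trans_le (min_le_right _ _))
  rw [← dist_eq_norm] at a b ⊢
  have := dist_triangle_left (J' t s) (J t s)
    (∑ i ∈ Finset.range n, S (t - π (i + 1)) (Ξ (π (i + 1)) (π i)))
  linarith

/-- Integration of weakly controlled paths against a step-3 convolutional rough path
`(X¹, X², X³)`: there is a unique continuous `J` with `δ̂J = 0` and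
`J − X¹ y − X² y¹ − X³ y² ∈ Ĉ₂^{κ₀+3κ}`, and `J` is the limit of the corrected,
semigroup-weighted Riemann sums. -/
theorem stmt13 [CompleteSpace B] (T M : ℝ) (hT : 0 < T) (hM : 1 ≤ M)
    (S : ℝ → B →L[ℝ] B) (hS : IsSG S M)
    (κ₀ κ : ℝ) (hκ : 0 < κ) (hκκ₀ : κ < κ₀) (hreg : 1 < κ₀ + 3 * κ)
    (X1 X2 X3 : ℝ → ℝ → B →L[ℝ] B) (K : ℝ) (hK : 0 ≤ K)
    (hc1 : ContinuousOn (fun q : ℝ × ℝ => X1 q.1 q.2)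
      {q : ℝ × ℝ | 0 ≤ q.2 ∧ q.2 ≤ q.1 ∧ q.1 ≤ T})
    (hc2 : ContinuousOn (fun q : ℝ × ℝ => X2 q.1 q.2)
      {q : ℝ × ℝ | 0 ≤ q.2 ∧ q.2 ≤ q.1 ∧ q.1 ≤ T})
    (hc3 : ContinuousOn (fun q : ℝ × ℝ => X3 q.1 q.2)
      {q : ℝ × ℝ | 0 ≤ q.2 ∧ q.2 ≤ q.1 ∧ q.1 ≤ T})
    (hd1 : ∀ t ∈ Set.Icc (0 : ℝ) T, X1 t t = 0)
    (hd2 : ∀ t ∈ Set.Icc (0 : ℝ) T, X2 t t = 0)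
    (hd3 : ∀ t ∈ Set.Icc (0 : ℝ) T, X3 t t = 0)
    (hb1 : ∀ t s : ℝ, 0 ≤ s → s ≤ t → t ≤ T → ‖X1 t s‖ ≤ K * (t - s) ^ κ₀)
    (hb2 : ∀ t s : ℝ, 0 ≤ s → s ≤ t → t ≤ T → ‖X2 t s‖ ≤ K * (t - s) ^ (2 * κ₀))
    (hb3 : ∀ t s : ℝ, 0 ≤ s → s ≤ t → t ≤ T → ‖X3 t s‖ ≤ K * (t - s) ^ (3 * κ₀))
    (hch1 : ∀ t u s : ℝ, 0 ≤ s → s ≤ u → u ≤ t → t ≤ T →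
      X1 t s = (X1 t u).comp (S (u - s)) + (S (t - u)).comp (X1 u s))
    (hch2 : ∀ t u s : ℝ, 0 ≤ s → s ≤ u → u ≤ t → t ≤ T →
      X2 t s = (X2 t u).comp (S (u - s)) + (S (t - u)).comp (X2 u s) +
        (X1 t u).comp (X1 u s))
    (hch3 : ∀ t u s : ℝ, 0 ≤ s → s ≤ u → u ≤ t → t ≤ T →
      X3 t s = (X3 t u).comp (S (u - s)) + (S (t - u)).comp (X3 u s) +
        (X1 t u).comp (X2 u s) + (X2 t u).comp (X1 u s))
    (y y1 y2 : ℝ → B)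
    (hy : ContinuousOn y (Set.Icc 0 T))
    (hy1 : ContinuousOn y1 (Set.Icc 0 T))
    (hy2 : ContinuousOn y2 (Set.Icc 0 T))
    (hyb : ∃ C : ℝ, ∀ t ∈ Set.Icc (0 : ℝ) T, ‖y t‖ ≤ C)
    (hy1b : ∃ C : ℝ, ∀ t ∈ Set.Icc (0 : ℝ) T, ‖y1 t‖ ≤ C)
    (hy2b : ∃ C : ℝ, ∀ t ∈ Set.Icc (0 : ℝ) T, ‖y2 t‖ ≤ C)
    (hδy2 : ∃ K2 : ℝ, 0 ≤ K2 ∧ ∀ t s : ℝ, 0 ≤ s → s ≤ t → t ≤ T →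
      ‖y2 t - S (t - s) (y2 s)‖ ≤ K2 * (t - s) ^ κ)
    (hy1r : ∃ K1r : ℝ, 0 ≤ K1r ∧ ∀ t s : ℝ, 0 ≤ s → s ≤ t → t ≤ T →
      ‖(y1 t - S (t - s) (y1 s)) - X1 t s (y2 s)‖ ≤ K1r * (t - s) ^ (2 * κ))
    (hyr : ∃ Kr : ℝ, 0 ≤ Kr ∧ ∀ t s : ℝ, 0 ≤ s → s ≤ t → t ≤ T →
      ‖(y t - S (t - s) (y s)) - X1 t s (y1 s) - X2 t s (y2 s)‖ ≤ Kr * (t - s) ^ (3 * κ)) :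
    ∃ J : ℝ → ℝ → B,
      (ContinuousOn (fun q : ℝ × ℝ => J q.1 q.2)
          {q : ℝ × ℝ | 0 ≤ q.2 ∧ q.2 ≤ q.1 ∧ q.1 ≤ T} ∧
        (∀ t u s : ℝ, 0 ≤ s → s ≤ u → u ≤ t → t ≤ T →
          J t s = J t u + S (t - u) (J u s)) ∧
        (∃ K' : ℝ, 0 ≤ K' ∧ ∀ t s : ℝ, 0 ≤ s → s ≤ t → t ≤ T →
          ‖J t s - X1 t s (y s) - X2 t s (y1 s) - X3 t s (y2 s)‖ ≤
            K' * (t - s) ^ (κ₀ + 3 * κ))) ∧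
      (∀ J' : ℝ → ℝ → B,
        (ContinuousOn (fun q : ℝ × ℝ => J' q.1 q.2)
            {q : ℝ × ℝ | 0 ≤ q.2 ∧ q.2 ≤ q.1 ∧ q.1 ≤ T} ∧
          (∀ t u s : ℝ, 0 ≤ s → s ≤ u → u ≤ t → t ≤ T →
            J' t s = J' t u + S (t - u) (J' u s)) ∧
          (∃ K' : ℝ, 0 ≤ K' ∧ ∀ t s : ℝ, 0 ≤ s → s ≤ t → t ≤ T →
            ‖J' t s - X1 t s (y s) - X2 t s (y1 s) - X3 t s (y2 s)‖ ≤
              K' * (t - s) ^ (κ₀ + 3 * κ))) →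
        ∀ t s : ℝ, 0 ≤ s → s ≤ t → t ≤ T → J' t s = J t s) ∧
      ∀ t s : ℝ, 0 ≤ s → s < t → t ≤ T → ∀ ε : ℝ, 0 < ε → ∃ δ : ℝ, 0 < δ ∧
        ∀ (n : ℕ) (π : ℕ → ℝ), π 0 = s → π n = t →
          (∀ i < n, π i < π (i + 1)) → (∀ i < n, π (i + 1) - π i < δ) →
          ‖(∑ i ∈ Finset.range n,
              S (t - π (i + 1))
                (X1 (π (i + 1)) (π i) (y (π i)) + X2 (π (i + 1)) (π i) (y1 (π i)) +
                  X3 (π (i + 1)) (π i) (y2 (π i)))) - J t s‖ < ε := by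
  obtain ⟨K2, hK2, hδy2⟩ := hδy2
  obtain ⟨K1r, hK1r, hy1r⟩ := hy1r
  obtain ⟨Kr, hKr, hyr⟩ := hyr
  set Ξ : ℝ → ℝ → B := fun t s => X1 t s (y s) + X2 t s (y1 s) + X3 t s (y2 s) with hΞ
  have hcΞ : ContinuousOn (fun q : ℝ × ℝ => Ξ q.1 q.2) (Simp T) := by
    have hm : Set.MapsTo (fun q : ℝ × ℝ => q.2) (Simp T) (Set.Icc 0 T) :=
      fun q hq => ⟨hq.1, hq.2.1.trans hq.2.2⟩
    have hs : ContinuousOn (fun q : ℝ × ℝ => q.2) (Simp T) := continuous_snd.continuousOn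
    exact ((hc1.clm_apply (hy.comp hs hm)).add (hc2.clm_apply (hy1.comp hs hm))).add
      (hc3.clm_apply (hy2.comp hs hm))
  have hdΞ : ∀ t, 0 ≤ t → t ≤ T → Ξ t t = 0 := by
    intro t h0 h1
    simp [hΞ, hd1 t ⟨h0, h1⟩, hd2 t ⟨h0, h1⟩, hd3 t ⟨h0, h1⟩]
  have pw : ∀ a b : ℝ, 0 ≤ a → 0 ≤ b → ∀ t u s : ℝ, s ≤ u → u ≤ t → 0 ≤ s → t ≤ T →
      κ₀ + 3 * κ ≤ a + b → (t - u) ^ a * (u - s) ^ b ≤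
        T ^ (a + b - (κ₀ + 3 * κ)) * (t - s) ^ (κ₀ + 3 * κ) := by
    intro a b ha hb t u s h1 h2 h0 h3 hab
    calc (t - u) ^ a * (u - s) ^ b ≤ (t - s) ^ a * (t - s) ^ b := by
          refine mul_le_mul (Real.rpow_le_rpow (by linarith) (by linarith) ha)
            (Real.rpow_le_rpow (by linarith) (by linarith) hb)
            (Real.rpow_nonneg (by linarith) _) (Real.rpow_nonneg (by linarith) _)
      _ = (t - s) ^ (a + b - (κ₀ + 3 * κ)) * (t - s) ^ (κ₀ + 3 * κ) := by
          rw [← Real.rpow_add_of_nonneg (by linarith) ha hb,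
            ← Real.rpow_add_of_nonneg (by linarith) (by linarith) (by linarith)]
          congr 1; ring
      _ ≤ _ := by
          refine mul_le_mul_of_nonneg_right (Real.rpow_le_rpow (by linarith) (by linarith)
            (by linarith)) (Real.rpow_nonneg (by linarith) _)
  have hδΞ : ∀ t u s, 0 ≤ s → s ≤ u → u ≤ t → t ≤ T →
      ‖Ξ t s - Ξ t u - S (t - u) (Ξ u s)‖ ≤
        (K * Kr * T ^ (κ₀ + 3 * κ - (κ₀ + 3 * κ))
          + K * K1r * T ^ (2 * κ₀ + 2 * κ - (κ₀ + 3 * κ))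
          + K * K2 * T ^ (3 * κ₀ + κ - (κ₀ + 3 * κ))) * (t - s) ^ (κ₀ + 3 * κ) := by
    intro t u s h0 h1 h2 h3
    have key : Ξ t s - Ξ t u - S (t - u) (Ξ u s) =
        - (X1 t u ((y u - S (u - s) (y s)) - X1 u s (y1 s) - X2 u s (y2 s))
          + X2 t u ((y1 u - S (u - s) (y1 s)) - X1 u s (y2 s))
          + X3 t u (y2 u - S (u - s) (y2 s))) := by
      simp only [hΞ]
      rw [hch1 t u s h0 h1 h2 h3, hch2 t u s h0 h1 h2 h3, hch3 t u s h0 h1 h2 h3]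
      simp only [ContinuousLinearMap.add_apply, ContinuousLinearMap.comp_apply, map_sub, map_add]
      abel
    rw [key, norm_neg]
    have gen : ∀ (X : B →L[ℝ] B) (x : B) (a b L : ℝ), 0 ≤ a → 0 ≤ b → 0 ≤ L →
        κ₀ + 3 * κ ≤ a + b → ‖X‖ ≤ K * (t - u) ^ a → ‖x‖ ≤ L * (u - s) ^ b →
        ‖X x‖ ≤ K * L * T ^ (a + b - (κ₀ + 3 * κ)) * (t - s) ^ (κ₀ + 3 * κ) := by
      intro X x a b L ha hb hL hab hX hx
      calc ‖X x‖ ≤ (K * (t - u) ^ a) * (L * (u - s) ^ b) :=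
            (X.le_opNorm x).trans (mul_le_mul hX hx (norm_nonneg _) ((norm_nonneg _).trans hX))
        _ = K * L * ((t - u) ^ a * (u - s) ^ b) := by ring
        _ ≤ K * L * (T ^ (a + b - (κ₀ + 3 * κ)) * (t - s) ^ (κ₀ + 3 * κ)) :=
            mul_le_mul_of_nonneg_left (pw a b ha hb t u s h1 h2 h0 h3 hab) (by positivity)
        _ = _ := by ring
    have g1 := gen _ _ κ₀ (3 * κ) Kr (by linarith) (by linarith) hKr (by linarith)
      (hb1 t u (h0.trans h1) h2 h3) (hyr u s h0 h1 (h2.trans h3))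
    have g2 := gen _ _ (2 * κ₀) (2 * κ) K1r (by linarith) (by linarith) hK1r (by linarith)
      (hb2 t u (h0.trans h1) h2 h3) (hy1r u s h0 h1 (h2.trans h3))
    have g3 := gen _ _ (3 * κ₀) κ K2 (by linarith) (by linarith) hK2 (by linarith)
      (hb3 t u (h0.trans h1) h2 h3) (hδy2 u s h0 h1 (h2.trans h3))
    refine (norm_add_le _ _).trans ((add_le_add ((norm_add_le _ _).trans
      (add_le_add g1 g2)) g3).trans (le_of_eq ?_))
    ring
  have hCnn : 0 ≤ K * Kr * T ^ (κ₀ + 3 * κ - (κ₀ + 3 * κ))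
          + K * K1r * T ^ (2 * κ₀ + 2 * κ - (κ₀ + 3 * κ))
          + K * K2 * T ^ (3 * κ₀ + κ - (κ₀ + 3 * κ)) := by positivity
  have sub3 : ∀ (Q : ℝ → ℝ → B) t s,
      Q t s - X1 t s (y s) - X2 t s (y1 s) - X3 t s (y2 s) = Q t s - Ξ t s := by
    intro Q t s; simp only [hΞ]; abel
  obtain ⟨J, hJc, hJa, K', hK', hJb⟩ := sewing hT hM hS hcΞ hdΞ hCnn hreg hδΞ
  refine ⟨J, ⟨hJc, hJa, K', hK', fun t s h0 h1 h2 => ?_⟩, ?_, ?_⟩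
  · rw [sub3]; exact hJb t s h0 h1 h2
  · rintro J' ⟨_, hJa', K'', hK'', hJb'⟩
    refine sew_unique_s13 hM hS hK' hK'' hreg hJa hJb hJa' (fun t s h0 h1 h2 => ?_)
    rw [← sub3]; exact hJb' t s h0 h1 h2
  · exact riemann_lim hM hS hK' hreg hJa hJb
end

section
/- (Cocycle property of the rough-path series.) Let κ_0 > 0, C > 0 and let (X^n)_{n≥1} be a family of continuous maps X^n : 𝒮_2 → L(B) vanishing on the diagonal, satisfying ‖X^n_{ts}‖_{op} ≤ C (n!)^{−κ_0} (t−s)^{nκ_0} for all n ≥ 1 and the Chen relations X^n_{ts} = X^n_{tu} S_{us} + S_{tu} X^n_{us} + Σ_{k=1}^{n−1} X^k_{tu} X^{n−k}_{us} for all n ≥ 1 and (t,u,s) ∈ 𝒮_3 (empty sum for n = 1). Set X^0_{ts} := S_{t−s}. Then for every (t,s) ∈ 𝒮_2 the series T̂_{ts} := Σ_{n≥0} X^n_{ts} converges absolutely in operator norm, and T̂ is a cocycle of operators: T̂_{ts} = T̂_{tu} ∘ T̂_{us} for every (t,u,s) ∈ 𝒮_3. -/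
open scoped BigOperators

universe u

variable {B : Type u} [NormedAddCommGroup B] [NormedSpace ℝ B]

/-- The rough path extended by its level zero `X⁰_{ts} = S_{t−s}`. -/
noncomputable def Xfull {B : Type u} [NormedAddCommGroup B] [NormedSpace ℝ B]
    (S : ℝ → B →L[ℝ] B) (X : ℕ → ℝ → ℝ → B →L[ℝ] B) (n : ℕ) (t s : ℝ) :
    B →L[ℝ] B :=
  if n = 0 then S (t - s) else X n t s

theorem aux_summable (a κ : ℝ) (ha : 0 ≤ a) (hκ : 0 < κ) :
    Summable fun n : ℕ => (a ^ n / (n.factorial : ℝ)) ^ κ := by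
  have hlim : Filter.Tendsto (fun n : ℕ => (a / ((n : ℝ) + 1)) ^ κ) Filter.atTop (nhds 0) := by
    have h1 : Filter.Tendsto (fun n : ℕ => a / ((n : ℝ) + 1)) Filter.atTop (nhds 0) :=
      Filter.Tendsto.div_atTop tendsto_const_nhds
        (Filter.tendsto_atTop_add_const_right _ _ tendsto_natCast_atTop_atTop)
    have h2 := h1.rpow_const (p := κ) (Or.inr hκ.le)
    rwa [Real.zero_rpow hκ.ne'] at h2
  refine summable_of_ratio_norm_eventually_le (r := 1 / 2) (by norm_num) ?_
  filter_upwards [hlim.eventually (gt_mem_nhds (show (0 : ℝ) < 1 / 2 by norm_num))] with n hn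
  have e : a ^ (n + 1) / ((n + 1).factorial : ℝ)
      = (a / ((n : ℝ) + 1)) * (a ^ n / (n.factorial : ℝ)) := by
    rw [Nat.factorial_succ]
    push_cast
    have := Nat.factorial_pos n
    field_simp
    try ring
  rw [Real.norm_of_nonneg (by positivity), Real.norm_of_nonneg (by positivity), e,
    Real.mul_rpow (by positivity) (by positivity)]
  exact mul_le_mul_of_nonneg_right hn.le (by positivity)

/-- Cocycle property of the rough-path series: under the factorial bounds
`‖Xⁿ_{ts}‖ ≤ C (n!)^{−κ₀} (t−s)^{nκ₀}` and the Chen relations, the series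
`T̂_{ts} = Σ_{n≥0} Xⁿ_{ts}` (with `X⁰ = S`) converges absolutely in operator norm
and satisfies `T̂_{ts} = T̂_{tu} ∘ T̂_{us}`. -/
theorem stmt15 [CompleteSpace B] (T : ℝ) (hT : 0 < T) (S : ℝ → B →L[ℝ] B)
    (M : ℝ) (hM : 1 ≤ M) (hS : IsSG S M) (κ₀ C : ℝ) (hκ₀ : 0 < κ₀) (hC : 0 < C)
    (X : ℕ → ℝ → ℝ → B →L[ℝ] B)
    (hcont : ∀ n : ℕ, 1 ≤ n → ContinuousOn (fun q : ℝ × ℝ => X n q.1 q.2)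
      {q : ℝ × ℝ | 0 ≤ q.2 ∧ q.2 ≤ q.1 ∧ q.1 ≤ T})
    (hdiag : ∀ n : ℕ, 1 ≤ n → ∀ t ∈ Set.Icc (0 : ℝ) T, X n t t = 0)
    (hbound : ∀ n : ℕ, 1 ≤ n → ∀ t s : ℝ, 0 ≤ s → s ≤ t → t ≤ T →
      ‖X n t s‖ ≤ C * (n.factorial : ℝ) ^ (-κ₀) * (t - s) ^ ((n : ℝ) * κ₀))
    (hchen : ∀ n : ℕ, 1 ≤ n → ∀ t u s : ℝ, 0 ≤ s → s ≤ u → u ≤ t → t ≤ T →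
      X n t s = (X n t u).comp (S (u - s)) + (S (t - u)).comp (X n u s) +
        ∑ k ∈ Finset.Ico 1 n, (X k t u).comp (X (n - k) u s)) :
    (∀ t s : ℝ, 0 ≤ s → s ≤ t → t ≤ T →
      Summable fun n : ℕ => ‖Xfull S X n t s‖) ∧
    ∀ t u s : ℝ, 0 ≤ s → s ≤ u → u ≤ t → t ≤ T →
      (∑' n : ℕ, Xfull S X n t s) =
        (∑' n : ℕ, Xfull S X n t u).comp (∑' n : ℕ, Xfull S X n u s) := by
  have hsum : ∀ t s : ℝ, 0 ≤ s → s ≤ t → t ≤ T →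
      Summable fun n : ℕ => ‖Xfull S X n t s‖ := by
    intro t s hs hst ht
    rw [← summable_nat_add_iff 1]
    have h := (summable_nat_add_iff 1).2
      ((aux_summable (t - s) κ₀ (sub_nonneg.2 hst) hκ₀).mul_left C)
    refine Summable.of_nonneg_of_le (fun n => norm_nonneg _) (fun n => ?_) h
    have hb := hbound (n + 1) (by omega) t s hs hst ht
    have ha : 0 ≤ t - s := sub_nonneg.2 hst
    simp only [Xfull, Nat.succ_ne_zero, if_false]
    refine hb.trans (le_of_eq ?_)
    rw [Real.div_rpow (by positivity) (by positivity), Real.rpow_neg (by positivity),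
      Real.rpow_mul ha, Real.rpow_natCast, div_eq_mul_inv]
    ring
  refine ⟨hsum, ?_⟩
  intro t u s hs hsu hut ht
  have h := tsum_mul_tsum_eq_tsum_sum_range_of_summable_norm
    (hsum t u (hs.trans hsu) hut ht) (hsum u s hs hsu (hut.trans ht))
  change _ = (∑' n : ℕ, Xfull S X n t u) * (∑' n : ℕ, Xfull S X n u s)
  rw [h]
  congr 1
  funext n
  rcases Nat.eq_zero_or_pos n with rfl | hn
  · have := hS.2.1 (u - s) (t - u) (by linarith) (by linarith)
    rw [show t - u + (u - s) = t - s by ring] at this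
    simp only [Xfull, zero_add, Finset.sum_range_one, if_true, Nat.sub_self]
    exact this
  · have hc := hchen n hn t u s hs hsu hut ht
    have hI : ∑ k ∈ Finset.Ico 1 n, Xfull S X k t u * Xfull S X (n - k) u s
        = ∑ k ∈ Finset.Ico 1 n, (X k t u).comp (X (n - k) u s) := by
      refine Finset.sum_congr rfl fun k hk => ?_
      rw [Finset.mem_Ico] at hk
      have h1 : k ≠ 0 := by omega
      have h2 : n - k ≠ 0 := by omega
      simp only [Xfull, h1, h2, if_false]
      rfl
    rw [Finset.sum_range_succ, Finset.range_eq_Ico, Finset.sum_eq_sum_Ico_succ_bot hn, zero_add, hI]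
    have hn0 : n ≠ 0 := hn.ne'
    simp only [Xfull, hn0, if_false, Nat.sub_self, Nat.sub_zero, if_true]
    rw [hc]
    change _ = (S (t - u)).comp (X n u s) + _ + (X n t u).comp (S (u - s))
    abel
end

section
/- Let H ∈ (1/2, 1] and let a, b > 0 satisfy 2H − a > 0 and 2H − b > 0. Then the function (u,v) ↦ |u−v|^{2H−2} (2−u−v)^{−a} (u+v)^{−b} is integrable on (0,1) × (0,1), i.e. ∫_0^1 ∫_0^1 |u−v|^{2H−2} (2−u−v)^{−a} (u+v)^{−b} du dv < ∞. -/
open MeasureTheory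

lemma aux_bound (x y s c b : ℝ) (hx : 0 < x) (hy : 0 < y) (hxs : x ≤ s) (hys : y ≤ s)
    (hc : -1 < c) (hb : 0 < b) :
    x ^ c * s ^ (-b) ≤ x ^ (c - b * (1 + c) / (2 + c)) * y ^ (-(b / (2 + c))) := by
  have hs : 0 < s := lt_of_lt_of_le hx hxs
  have h2 : 0 < 2 + c := by linarith
  have h1 : 0 < 1 + c := by linarith
  have e : -b = -(b * (1 + c) / (2 + c)) + -(b / (2 + c)) := by field_simp; ring
  have hp : 0 ≤ b * (1 + c) / (2 + c) := by positivity
  have hq : 0 ≤ b / (2 + c) := by positivity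
  rw [sub_eq_add_neg, Real.rpow_add hx, e, Real.rpow_add hs, mul_assoc]
  have i1 := Real.rpow_le_rpow_of_nonpos hx hxs (neg_nonpos.2 hp)
  have i2 := Real.rpow_le_rpow_of_nonpos hy hys (neg_nonpos.2 hq)
  gcongr

lemma aux_abs (r : ℝ) (hr : -1 < r) :
    Integrable (Set.indicator (Set.Ioo (-1 : ℝ) 1) (fun w : ℝ => |w| ^ r)) := by
  rw [integrable_indicator_iff measurableSet_Ioo]
  have h1 : IntervalIntegrable (fun w : ℝ => |w| ^ r) volume 0 1 := by
    refine (intervalIntegral.intervalIntegrable_rpow' (a := 0) (b := 1) hr).congr ?_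
    intro x hx
    rw [Set.uIoc_of_le zero_le_one] at hx
    simp [abs_of_pos hx.1]
  have h2 : IntervalIntegrable (fun w : ℝ => |w| ^ r) volume (-1) 0 := by
    have := (IntervalIntegrable.iff_comp_neg (f := fun w : ℝ => |w| ^ r)).1 h1
    simpa using this.symm
  have h3 := h2.trans h1
  rw [intervalIntegrable_iff_integrableOn_Ioo_of_le (by norm_num)] at h3
  exact h3

lemma aux_prod (f : ℝ → ℝ) (r : ℝ) (hr : -1 < r) (hf : IntegrableOn f (Set.Ioo 0 1)) :
    IntegrableOn (fun q : ℝ × ℝ => |q.1 - q.2| ^ r * f q.2)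
      (Set.Ioo (0 : ℝ) 1 ×ˢ Set.Ioo (0 : ℝ) 1) := by
  have hf' := (integrable_indicator_iff measurableSet_Ioo).2 hf
  have h := hf'.convolution_integrand (ContinuousLinearMap.mul ℝ ℝ) (aux_abs r hr)
  refine (h.integrableOn (s := Set.Ioo (0 : ℝ) 1 ×ˢ Set.Ioo (0 : ℝ) 1)).congr_fun ?_
    (measurableSet_Ioo.prod measurableSet_Ioo)
  rintro ⟨u, v⟩ ⟨⟨hu0, hu1⟩, ⟨hv0, hv1⟩⟩
  simp only at hu0 hu1 hv0 hv1
  have m1 : v ∈ Set.Ioo (0:ℝ) 1 := ⟨hv0, hv1⟩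
  have m2 : u - v ∈ Set.Ioo (-1:ℝ) 1 := ⟨by linarith, by linarith⟩
  simp [Set.indicator_of_mem m1, Set.indicator_of_mem m2, mul_comm]

lemma aux_diag : ∀ᵐ q : ℝ × ℝ, q.1 ≠ q.2 := by
  have : (volume : Measure (ℝ × ℝ)) {q | q.1 = q.2} = 0 := by
    rw [Measure.volume_eq_prod, Measure.measure_prod_null
      (measurableSet_eq_fun measurable_fst measurable_snd)]
    filter_upwards with x
    have : Prod.mk x ⁻¹' {q : ℝ × ℝ | q.1 = q.2} = {x} := by
      ext y; simp [eq_comm]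
    simp [this]
  rw [ae_iff]
  simpa using this

lemma aux_rpow (q : ℝ) (hq : q < 1) : IntegrableOn (fun v : ℝ => v ^ (-q)) (Set.Ioo 0 1) := by
  have := intervalIntegral.intervalIntegrable_rpow' (a := 0) (b := 1) (r := -q) (by linarith)
  rwa [intervalIntegrable_iff_integrableOn_Ioo_of_le (by norm_num)] at this

lemma aux_rpow' (q : ℝ) (hq : q < 1) :
    IntegrableOn (fun v : ℝ => (1 - v) ^ (-q)) (Set.Ioo 0 1) := by
  have := intervalIntegral.intervalIntegrable_rpow' (a := 0) (b := 1) (r := -q) (by linarith)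
  have := (this.comp_sub_left 1).symm
  simp only [sub_zero, sub_self] at this
  rwa [intervalIntegrable_iff_integrableOn_Ioo_of_le (by norm_num)] at this

lemma aux_exp (c b : ℝ) (hc : -1 < c) (h : b < 2 + c) :
    -1 < c - b * (1 + c) / (2 + c) ∧ b / (2 + c) < 1 := by
  have h2 : 0 < 2 + c := by linarith
  have h1 : 0 < 1 + c := by linarith
  have hq : b / (2 + c) < 1 := by rw [div_lt_one h2]; exact h
  refine ⟨?_, hq⟩
  have : b * (1 + c) / (2 + c) = (1 + c) * (b / (2 + c)) := by ring
  rw [this]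
  nlinarith

/-- For `H ∈ (1/2, 1]` and `a, b > 0` with `2H − a > 0` and `2H − b > 0`, the function
`(u,v) ↦ |u−v|^{2H−2} (2−u−v)^{−a} (u+v)^{−b}` is (Lebesgue-)integrable on the open
unit square. -/
theorem stmt17 (H a b : ℝ) (hH1 : 1 / 2 < H) (hH2 : H ≤ 1)
    (ha : 0 < a) (hb : 0 < b) (hHa : 0 < 2 * H - a) (hHb : 0 < 2 * H - b) :
    IntegrableOn
      (fun q : ℝ × ℝ =>
        |q.1 - q.2| ^ (2 * H - 2) * (2 - q.1 - q.2) ^ (-a) * (q.1 + q.2) ^ (-b))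
      (Set.Ioo (0 : ℝ) 1 ×ˢ Set.Ioo (0 : ℝ) 1) := by
  obtain ⟨c, hc⟩ : ∃ c, c = 2 * H - 2 := ⟨_, rfl⟩
  rw [← hc]
  have hc1 : -1 < c := by linarith
  obtain ⟨ea, ea'⟩ := aux_exp c a hc1 (by linarith)
  obtain ⟨eb, eb'⟩ := aux_exp c b hc1 (by linarith)
  have I := (aux_prod _ _ ea (aux_rpow' _ ea')).add (aux_prod _ _ eb (aux_rpow _ eb'))
  refine Integrable.mono' I (by apply Measurable.aestronglyMeasurable; fun_prop) ?_
  filter_upwards [ae_restrict_mem (measurableSet_Ioo.prod measurableSet_Ioo),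
    ae_restrict_of_ae aux_diag] with q hq hne
  obtain ⟨u, v⟩ := q
  obtain ⟨⟨hu0, hu1⟩, ⟨hv0, hv1⟩⟩ := hq
  simp only at hu0 hu1 hv0 hv1 hne
  have hx : 0 < |u - v| := abs_pos.2 (sub_ne_zero.2 hne)
  have hA := aux_bound |u - v| (1 - v) (2 - u - v) c a hx (by linarith)
    (abs_le.2 ⟨by linarith, by linarith⟩) (by linarith) hc1 ha
  have hB := aux_bound |u - v| v (u + v) c b hx hv0
    (abs_le.2 ⟨by linarith, by linarith⟩) (by linarith) hc1 hb
  have p0 : 0 ≤ |u - v| ^ c := by positivity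
  have p1 : 0 ≤ (2 - u - v) ^ (-a) := Real.rpow_nonneg (by linarith) _
  have p2 : 0 ≤ (u + v) ^ (-b) := Real.rpow_nonneg (by linarith) _
  have p01 := mul_nonneg p0 p1
  have p02 := mul_nonneg p0 p2
  simp only [Pi.add_apply]
  rw [Real.norm_of_nonneg (mul_nonneg p01 p2)]
  rcases le_total (u + v) 1 with h | h
  · have k : (2 - u - v) ^ (-a) ≤ 1 :=
      Real.rpow_le_one_of_one_le_of_nonpos (by linarith) (by linarith)
    nlinarith [mul_le_mul_of_nonneg_left k p02]
  · have k : (u + v) ^ (-b) ≤ 1 :=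
      Real.rpow_le_one_of_one_le_of_nonpos h (by linarith)
    nlinarith [mul_le_mul_of_nonneg_left k p01]
end
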